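/- arXiv:1406.6956 — 4 statements merged into one kernel-verified Lean document; each statement's English description precedes it below -/
import Mathlib

section
/- For every α ∈ (1, 3/2), every δ > 0, and every ε ∈ (0,1), there exist a constant c > 0, an integer S₀ ≥ 2, and a family of functions Ĥ_{n,S} : ℕ^S → ℝ such that for all integers S ≥ S₀, all integers n with n·ln S ≥ c·S, and all P ∈ M_S, under the Poissonized sampling model with parameter n one has P(|Ĥ_{n,S}(Z) − H_α(P)| ≥ δ) ≤ ε. In words, the Rényi entropy H_α(P), 1 < α < 3/2, can be estimated consistently with high probability using c·S/ln S samples. -/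
open scoped BigOperators ENNReal

/-- The probability simplex on `S` outcomes. -/
def simplex (S : ℕ) : Set (Fin S → ℝ) :=
  {P | (∀ i, 0 ≤ P i) ∧ ∑ i, P i = 1}

/-- Joint pmf of independent Poisson observations `Z i ~ Poisson (lam * P i)`. -/
noncomputable def poissonPMF (S : ℕ) (lam : ℝ) (P : Fin S → ℝ) (z : Fin S → ℕ) : ℝ :=
  ∏ i, Real.exp (-(lam * P i)) * (lam * P i) ^ (z i) / (Nat.factorial (z i) : ℝ)

open Classical in
/-- Probability of the event `A` under the Poissonized model. -/
noncomputable def poissonProb (S : ℕ) (lam : ℝ) (P : Fin S → ℝ)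
    (A : Set (Fin S → ℕ)) : ℝ≥0∞ :=
  ∑' z : Fin S → ℕ, if z ∈ A then ENNReal.ofReal (poissonPMF S lam P z) else 0

/-- The power-sum functional `F_α(P) = ∑ i, (P i)^α` (real power; `0^α = 0` for `α > 0`). -/
noncomputable def Falpha (S : ℕ) (α : ℝ) (P : Fin S → ℝ) : ℝ :=
  ∑ i, P i ^ α

/-- The Rényi entropy `H_α(P) = ln F_α(P) / (1 - α)`. -/
noncomputable def renyi (S : ℕ) (α : ℝ) (P : Fin S → ℝ) : ℝ :=
  (1 / (1 - α)) * Real.log (Falpha S α P)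
/-- The Laguerre polynomial of degree `z`. -/
noncomputable def laguerre (z : ℕ) (w : ℝ) : ℝ :=
  ∑ k ∈ Finset.range (z + 1), (z.choose k : ℝ) * ((-1) ^ k / (k.factorial : ℝ)) * w ^ k

/-- The first derivative of `laguerre z`. -/
noncomputable def laguerreDeriv (z : ℕ) (w : ℝ) : ℝ :=
  ∑ k ∈ Finset.range (z + 1),
    (z.choose k : ℝ) * ((-1) ^ k / (k.factorial : ℝ)) * (k * w ^ (k - 1))

/-- The second derivative of `laguerre z`. -/
noncomputable def laguerreDerivTwo (z : ℕ) (w : ℝ) : ℝ :=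
  ∑ k ∈ Finset.range (z + 1),
    (z.choose k : ℝ) * ((-1) ^ k / (k.factorial : ℝ)) * (k * ((k - 1 : ℕ) * w ^ (k - 1 - 1)))

theorem hasDerivAt_laguerre (z : ℕ) (w : ℝ) :
    HasDerivAt (laguerre z) (laguerreDeriv z w) w := by
  unfold laguerre laguerreDeriv
  exact HasDerivAt.fun_sum fun k _ => (hasDerivAt_pow k w).const_mul _

theorem hasDerivAt_laguerreDeriv (z : ℕ) (w : ℝ) :
    HasDerivAt (laguerreDeriv z) (laguerreDerivTwo z w) w := by
  unfold laguerreDeriv laguerreDerivTwo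
  exact HasDerivAt.fun_sum fun k _ => ((hasDerivAt_pow (k - 1) w).const_mul _).const_mul _

theorem continuous_laguerre (z : ℕ) : Continuous (laguerre z) := by
  unfold laguerre
  fun_prop

@[simp]
theorem laguerre_zero_left (w : ℝ) : laguerre 0 w = 1 := by
  simp [laguerre]

@[simp]
theorem laguerre_zero_right (z : ℕ) : laguerre z 0 = 1 := by
  simp [laguerre, Finset.sum_range_succ']

/-- The Laguerre differential equation. -/
theorem laguerre_ode (z : ℕ) (w : ℝ) :
    laguerreDeriv z w + w * laguerreDerivTwo z w = w * laguerreDeriv z w - z * laguerre z w := by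
  have hl : laguerreDeriv z w + w * laguerreDerivTwo z w =
      ∑ k ∈ Finset.range (z + 1),
        (z.choose k : ℝ) * ((-1) ^ k / (k.factorial : ℝ)) * ((k : ℝ) ^ 2 * w ^ (k - 1)) := by
    rw [laguerreDeriv, laguerreDerivTwo, Finset.mul_sum, ← Finset.sum_add_distrib]
    refine Finset.sum_congr rfl fun k _ => ?_
    rcases k with _ | _ | k
    · simp
    · simp
    · simp only [Nat.add_sub_cancel]
      push_cast
      ring
  have hr : w * laguerreDeriv z w - z * laguerre z w =
      ∑ k ∈ Finset.range (z + 1),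
        (z.choose k : ℝ) * ((-1) ^ k / (k.factorial : ℝ)) * (((k : ℝ) - z) * w ^ k) := by
    rw [laguerreDeriv, laguerre, Finset.mul_sum, Finset.mul_sum, ← Finset.sum_sub_distrib]
    refine Finset.sum_congr rfl fun k _ => ?_
    rcases k with _ | k
    · simp
    · simp only [Nat.add_sub_cancel]
      push_cast
      ring
  rw [hl, hr, Finset.sum_range_succ', Finset.sum_range_succ]
  simp only [Nat.cast_zero, sub_self, zero_mul, mul_zero, add_zero, ne_eq, OfNat.ofNat_ne_zero,
    not_false_eq_true, zero_pow]
  refine Finset.sum_congr rfl fun k hk => ?_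
  have hkz : k ≤ z := (Finset.mem_range.1 hk).le
  have h : ((z.choose (k + 1) : ℕ) : ℝ) * (k + 1) = z.choose k * ((z : ℝ) - k) := by
    rw [← Nat.cast_sub hkz]
    exact_mod_cast Nat.choose_succ_right_eq z k
  have hf : ((k + 1).factorial : ℝ) = (k + 1) * k.factorial := by
    push_cast [Nat.factorial_succ]
    ring
  have hk1 : (k : ℝ) + 1 ≠ 0 := by positivity
  have hk2 : (k.factorial : ℝ) ≠ 0 := by positivity
  simp only [Nat.add_sub_cancel, hf, Nat.cast_add, Nat.cast_one]
  have : ((z.choose (k + 1) : ℕ) : ℝ) * ((-1) ^ (k + 1) / ((k + 1) * (k.factorial : ℝ))) *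
      (((k : ℝ) + 1) ^ 2 * w ^ k) =
      ((z.choose (k + 1) : ℕ) : ℝ) * (k + 1) * ((-1) ^ (k + 1) / (k.factorial : ℝ) * w ^ k) := by
    field_simp
  rw [this, h]
  ring

/-- The structure relation linking the derivative to the difference in the degree. -/
theorem mul_laguerreDeriv_succ (z : ℕ) (w : ℝ) :
    w * laguerreDeriv (z + 1) w = (z + 1) * (laguerre (z + 1) w - laguerre z w) := by
  have hz : laguerre z w = ∑ k ∈ Finset.range (z + 1 + 1),
      (z.choose k : ℝ) * ((-1) ^ k / (k.factorial : ℝ)) * w ^ k := by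
    rw [Finset.sum_range_succ, ← laguerre, Nat.choose_succ_self]
    simp
  rw [hz, laguerre, laguerreDeriv, ← Finset.sum_sub_distrib, Finset.mul_sum, Finset.mul_sum]
  refine Finset.sum_congr rfl fun k _ => ?_
  rcases k with _ | k
  · simp
  · have h : ((z : ℝ) + 1) * z.choose k = ((z + 1).choose (k + 1) : ℕ) * ((k : ℝ) + 1) := by
      exact_mod_cast Nat.add_one_mul_choose_eq z k
    have h2 : (((z + 1).choose (k + 1) : ℕ) : ℝ) = z.choose k + z.choose (k + 1) := by
      exact_mod_cast Nat.choose_succ_succ z k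
    simp only [Nat.add_sub_cancel, Nat.cast_add, Nat.cast_one]
    linear_combination ((-1 : ℝ) ^ (k + 1) / ((k + 1).factorial : ℝ) * w ^ (k + 1)) *
      (-(z + 1) * h2 - h)

/-- The energy `z y² + w y'²` of `y = laguerre z` grows at most like `exp (2 w)`. -/
theorem laguerre_energy_le (z : ℕ) {w : ℝ} (hw : 0 ≤ w) :
    z * laguerre z w ^ 2 + w * laguerreDeriv z w ^ 2 ≤ z * Real.exp (2 * w) := by
  set g : ℝ → ℝ := fun v =>
    Real.exp (-(2 * v)) * (z * laguerre z v ^ 2 + v * laguerreDeriv z v ^ 2) with hg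
  have hd : ∀ v, HasDerivAt g
      (-(laguerreDeriv z v ^ 2 + 2 * z * laguerre z v ^ 2) * Real.exp (-(2 * v))) v := by
    intro v
    have h1 := hasDerivAt_laguerre z v
    have h2 := hasDerivAt_laguerreDeriv z v
    have h3 : HasDerivAt (fun v : ℝ => Real.exp (-(2 * v))) (Real.exp (-(2 * v)) * -(2 * 1)) v :=
      (((hasDerivAt_id v).const_mul 2).neg).exp
    have h4 := h3.mul (((h1.pow 2).const_mul (z : ℝ)).add ((hasDerivAt_id v).mul (h2.pow 2)))
    refine h4.congr_deriv ?_
    have ho := laguerre_ode z v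
    simp only [Pi.pow_apply, Pi.add_apply, Pi.mul_apply, id]
    push_cast
    linear_combination (2 * Real.exp (-(2 * v)) * laguerreDeriv z v) * ho
  have hanti : AntitoneOn g (Set.Ici 0) := by
    refine antitoneOn_of_deriv_nonpos (convex_Ici 0)
      (fun v _ => (hd v).continuousAt.continuousWithinAt)
      (fun v _ => (hd v).differentiableAt.differentiableWithinAt) fun v _ => ?_
    rw [(hd v).deriv]
    have := Real.exp_pos (-(2 * v))
    have h5 : 0 ≤ laguerreDeriv z v ^ 2 + 2 * z * laguerre z v ^ 2 := by positivity
    nlinarith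
  have h := hanti (Set.mem_Ici.2 le_rfl) (Set.mem_Ici.2 hw) hw
  simp only [hg, mul_zero, neg_zero, Real.exp_zero, one_mul, laguerre_zero_right, one_pow,
    mul_one, zero_mul, add_zero] at h
  have he : Real.exp (2 * w) * Real.exp (-(2 * w)) = 1 := by
    rw [← Real.exp_add]; simp
  calc z * laguerre z w ^ 2 + w * laguerreDeriv z w ^ 2
      = Real.exp (2 * w) * (Real.exp (-(2 * w)) *
          (z * laguerre z w ^ 2 + w * laguerreDeriv z w ^ 2)) := by
        rw [← mul_assoc, he, one_mul]
    _ ≤ Real.exp (2 * w) * z := by gcongr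
    _ = z * Real.exp (2 * w) := mul_comm _ _

theorem abs_laguerre_le (z : ℕ) {w : ℝ} (hw : 0 ≤ w) : |laguerre z w| ≤ Real.exp w := by
  rcases Nat.eq_zero_or_pos z with rfl | hz
  · simpa using hw
  · have hz' : (0 : ℝ) < z := by exact_mod_cast hz
    have h := laguerre_energy_le z hw
    have h2 : laguerre z w ^ 2 ≤ Real.exp w ^ 2 := by
      rw [← Real.exp_nat_mul]
      refine le_of_mul_le_mul_left ?_ hz'
      have : 0 ≤ w * laguerreDeriv z w ^ 2 := by positivity
      push_cast
      linarith
    exact abs_le_of_sq_le_sq h2 (Real.exp_pos w).le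

theorem abs_laguerre_succ_sub_le (z : ℕ) {w : ℝ} (hw : 0 ≤ w) :
    (z + 1) * |laguerre (z + 1) w - laguerre z w| ≤ √(z + 1) * (√w * Real.exp w) := by
  have h := laguerre_energy_le (z + 1) hw
  have h2 : (w * laguerreDeriv (z + 1) w) ^ 2 ≤ (√(z + 1) * (√w * Real.exp w)) ^ 2 := by
    have e : (√(z + 1) * (√w * Real.exp w)) ^ 2 = w * ((z + 1) * Real.exp (2 * w)) := by
      rw [mul_pow, mul_pow, Real.sq_sqrt (by positivity), Real.sq_sqrt hw, ← Real.exp_nat_mul]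
      push_cast
      ring
    rw [e]
    have h3 : (w * laguerreDeriv (z + 1) w) ^ 2 = w * (w * laguerreDeriv (z + 1) w ^ 2) := by ring
    rw [h3]
    refine mul_le_mul_of_nonneg_left ?_ hw
    have : 0 ≤ ((z + 1 : ℕ) : ℝ) * laguerre (z + 1) w ^ 2 := by positivity
    push_cast at h this
    linarith
  have h4 := abs_le_of_sq_le_sq h2 (by positivity)
  rw [mul_laguerreDeriv_succ, abs_mul, abs_of_nonneg (by positivity : (0 : ℝ) ≤ z + 1)] at h4
  exact h4

theorem abs_one_sub_laguerre_le (z : ℕ) {w : ℝ} (hw : 0 ≤ w) :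
    |1 - laguerre z w| ≤ 2 * √z * (√w * Real.exp w) := by
  induction z with
  | zero => simp
  | succ z ih =>
    have h := abs_laguerre_succ_sub_le z hw
    have hb : 0 ≤ √w * Real.exp w := by positivity
    set b := √w * Real.exp w
    have hq : 0 < √((z : ℝ) + 1) := by positivity
    have hq2 : √((z : ℝ) + 1) * √((z : ℝ) + 1) = z + 1 := Real.mul_self_sqrt (by positivity)
    have hz2 : √(z : ℝ) * √(z : ℝ) = z := Real.mul_self_sqrt (by positivity)
    have hstep : √((z : ℝ) + 1) * |laguerre (z + 1) w - laguerre z w| ≤ b := by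
      refine le_of_mul_le_mul_left ?_ hq
      rw [← mul_assoc, hq2]
      exact h
    have hsq : √((z : ℝ) + 1) * (2 * √(z : ℝ)) + 1 ≤ √((z : ℝ) + 1) * (2 * √((z : ℝ) + 1)) := by
      nlinarith [sq_nonneg (√((z : ℝ) + 1) - √(z : ℝ))]
    have htri : |1 - laguerre (z + 1) w| ≤
        |1 - laguerre z w| + |laguerre (z + 1) w - laguerre z w| := by
      have := abs_sub_le 1 (laguerre z w) (laguerre (z + 1) w)
      rwa [abs_sub_comm (laguerre z w)] at this
    push_cast
    refine le_of_mul_le_mul_left ?_ hq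
    nlinarith [mul_le_mul_of_nonneg_right hsq hb, mul_le_mul_of_nonneg_left ih hq.le]

open MeasureTheory ProbabilityTheory in
theorem integrable_poissonMeasure_of_abs_le_exp (r : NNReal) {g : ℕ → ℝ} {C : ℝ}
    (hg : ∀ z, |g z| ≤ C * Real.exp z) : Integrable g (poissonMeasure r) := by
  rw [integrable_poissonMeasure_iff]
  have h := ((Real.summable_pow_div_factorial (r * Real.exp 1)).mul_left (Real.exp (-r) * C))
  refine Summable.of_nonneg_of_le (fun z => by positivity) (fun z => ?_) h
  rw [Real.norm_eq_abs]
  calc Real.exp (-r) * (r : ℝ) ^ z / z.factorial * |g z|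
      ≤ Real.exp (-r) * (r : ℝ) ^ z / z.factorial * (C * Real.exp z) := by
        gcongr
        exact hg z
    _ = Real.exp (-r) * C * ((r * Real.exp 1) ^ z / z.factorial) := by
        rw [mul_pow, ← Real.exp_nat_mul, mul_one]
        ring

open MeasureTheory ProbabilityTheory in
/-- The Stein–Chen identity `E[Z h(Z - 1)] = r E[h(Z)]` for the Poisson law. -/
theorem integral_poissonMeasure_mul_pred (r : NNReal) {h : ℕ → ℝ} {C : ℝ}
    (hh : ∀ z, |h z| ≤ C * Real.exp z) :
    Integrable (fun z : ℕ => (z : ℝ) * h (z - 1)) (poissonMeasure r) ∧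
      ∫ z : ℕ, (z : ℝ) * h (z - 1) ∂poissonMeasure r = r * ∫ z, h z ∂poissonMeasure r := by
  have hsum := (integrable_poissonMeasure_iff.1 (integrable_poissonMeasure_of_abs_le_exp r hh))
  have hshift : ∀ z : ℕ, Real.exp (-r) * (r : ℝ) ^ (z + 1) / (z + 1).factorial *
      (((z + 1 : ℕ) : ℝ) * h (z + 1 - 1)) =
      r * (Real.exp (-r) * (r : ℝ) ^ z / z.factorial * h z) := by
    intro z
    have h1 : ((z + 1).factorial : ℝ) = (z + 1) * z.factorial := by
      push_cast [Nat.factorial_succ]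
      ring
    have h2 : (z : ℝ) + 1 ≠ 0 := by positivity
    rw [h1, Nat.add_sub_cancel]
    push_cast
    field_simp
    ring
  have hInt : Integrable (fun z : ℕ => (z : ℝ) * h (z - 1)) (poissonMeasure r) := by
    rw [integrable_poissonMeasure_iff, ← summable_nat_add_iff 1]
    refine (hsum.mul_left (r : ℝ)).congr fun z => ?_
    have h3 := congrArg abs (hshift z)
    rw [abs_mul, abs_of_nonneg (by positivity), abs_mul (r : ℝ), abs_of_nonneg r.coe_nonneg,
      abs_mul (Real.exp (-r) * (r : ℝ) ^ z / z.factorial),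
      abs_of_nonneg (a := Real.exp (-r) * (r : ℝ) ^ z / z.factorial) (by positivity)] at h3
    exact h3.symm
  refine ⟨hInt, ?_⟩
  rw [integral_poissonMeasure, integral_poissonMeasure,
    (hasSum_integral_poissonMeasure hInt).summable.tsum_eq_zero_add, ← tsum_mul_left]
  simp only [smul_eq_mul, Nat.cast_zero, zero_mul, mul_zero, zero_add]
  exact tsum_congr hshift

theorem natCast_add_one_pow_le (z k : ℕ) :
    |((z : ℝ) + 1) ^ k| ≤ (k.factorial * Real.exp 1) * Real.exp z := by
  rw [abs_of_nonneg (by positivity), mul_assoc, ← Real.exp_add, add_comm 1]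
  have := Real.pow_div_factorial_le_exp ((z : ℝ) + 1) (by positivity) k
  rwa [div_le_iff₀' (by positivity)] at this

open MeasureTheory ProbabilityTheory in
theorem integrable_natCast_pow_poissonMeasure (r : NNReal) (k : ℕ) :
    Integrable (fun z : ℕ => (z : ℝ) ^ k) (poissonMeasure r) := by
  refine integrable_poissonMeasure_of_abs_le_exp r (C := k.factorial * Real.exp 1) fun z => ?_
  refine le_trans ?_ (natCast_add_one_pow_le z k)
  rw [abs_of_nonneg (by positivity), abs_of_nonneg (by positivity)]
  gcongr
  linarith

open MeasureTheory ProbabilityTheory in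
theorem integral_natCast_pow_succ_poissonMeasure (r : NNReal) (k : ℕ) :
    ∫ z : ℕ, (z : ℝ) ^ (k + 1) ∂poissonMeasure r =
      r * ∫ z : ℕ, ((z : ℝ) + 1) ^ k ∂poissonMeasure r := by
  rw [← (integral_poissonMeasure_mul_pred r (fun z => natCast_add_one_pow_le z k)).2]
  congr 1
  ext z
  rcases z with _ | z
  · simp
  · simp only [Nat.add_sub_cancel]
    push_cast
    ring

open MeasureTheory ProbabilityTheory in
theorem integral_natCast_poissonMeasure (r : NNReal) :
    ∫ z : ℕ, (z : ℝ) ∂poissonMeasure r = r := by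
  simpa using integral_natCast_pow_succ_poissonMeasure r 0

open MeasureTheory ProbabilityTheory in
theorem integral_natCast_sq_poissonMeasure (r : NNReal) :
    ∫ z : ℕ, (z : ℝ) ^ 2 ∂poissonMeasure r = r ^ 2 + r := by
  have h1 : Integrable (fun z : ℕ => (z : ℝ)) (poissonMeasure r) := by
    simpa using integrable_natCast_pow_poissonMeasure r 1
  rw [integral_natCast_pow_succ_poissonMeasure r 1]
  simp only [pow_one]
  rw [integral_add h1 (integrable_const _), integral_natCast_poissonMeasure]
  simp
  ring

open MeasureTheory ProbabilityTheory in
theorem integral_natCast_cube_poissonMeasure (r : NNReal) :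
    ∫ z : ℕ, (z : ℝ) ^ 3 ∂poissonMeasure r = r ^ 3 + 3 * r ^ 2 + r := by
  have h1 : Integrable (fun z : ℕ => (z : ℝ)) (poissonMeasure r) := by
    simpa using integrable_natCast_pow_poissonMeasure r 1
  have h2 := integrable_natCast_pow_poissonMeasure r 2
  rw [integral_natCast_pow_succ_poissonMeasure r 2]
  have : ∀ z : ℕ, ((z : ℝ) + 1) ^ 2 = (z : ℝ) ^ 2 + (2 * (z : ℝ) + 1) := fun z => by ring
  simp only [this]
  rw [integral_add (g := fun z : ℕ => 2 * (z : ℝ) + 1) h2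
      ((h1.const_mul 2).add (integrable_const _)),
    integral_add (h1.const_mul 2) (integrable_const _), integral_const_mul,
    integral_natCast_poissonMeasure, integral_natCast_sq_poissonMeasure]
  simp
  ring

/-- The Bessel-type series `∑ (-x)^k / (k!)²`, that is `J₀ (2 √x)`. -/
noncomputable def besselSeries (x : ℝ) : ℝ :=
  ∑' k : ℕ, (-x) ^ k / (k.factorial : ℝ) ^ 2

theorem summable_norm_besselSeries (x : ℝ) :
    Summable fun k : ℕ => ‖(-x) ^ k / (k.factorial : ℝ) ^ 2‖ := by
  refine Summable.of_nonneg_of_le (fun k => norm_nonneg _) (fun k => ?_)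
    (Real.summable_pow_div_factorial |x|)
  have h1 : (1 : ℝ) ≤ k.factorial := by exact_mod_cast k.factorial_pos
  rw [Real.norm_eq_abs, abs_div, abs_pow, abs_neg, abs_of_nonneg (by positivity : (0 : ℝ) ≤
    (k.factorial : ℝ) ^ 2)]
  gcongr
  nlinarith

theorem measurable_besselSeries : Measurable besselSeries := by
  refine measurable_of_tendsto_metrizable
    (f := fun (N : ℕ) (x : ℝ) => ∑ k ∈ Finset.range N, (-x) ^ k / (k.factorial : ℝ) ^ 2)
    (fun N => by fun_prop) ?_
  rw [tendsto_pi_nhds]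
  intro x
  exact (summable_norm_besselSeries x).of_norm.hasSum.tendsto_sum_nat

open MeasureTheory ProbabilityTheory in
theorem integrable_laguerre_poissonMeasure (r : NNReal) {w : ℝ} (hw : 0 ≤ w) :
    Integrable (fun z => laguerre z w) (poissonMeasure r) := by
  refine integrable_poissonMeasure_of_abs_le_exp r (C := Real.exp w) fun z => ?_
  have h1 := abs_laguerre_le z hw
  have h2 : (1 : ℝ) ≤ Real.exp z := Real.one_le_exp (by positivity)
  nlinarith [Real.exp_pos w]

open MeasureTheory ProbabilityTheory in
/-- The Poisson transform of the Laguerre polynomials. -/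
theorem integral_laguerre_poissonMeasure (r : NNReal) (w : ℝ) :
    ∫ z, laguerre z w ∂poissonMeasure r = besselSeries (w * r) := by
  have hexp : Summable fun k : ℕ => ‖(r : ℝ) ^ k / (k.factorial : ℝ)‖ :=
    (Real.summable_pow_div_factorial (r : ℝ)).norm
  have hprod := tsum_mul_tsum_eq_tsum_sum_antidiagonal_of_summable_norm
    (summable_norm_besselSeries (w * r)) hexp
  have he : ∑' k : ℕ, (r : ℝ) ^ k / (k.factorial : ℝ) = Real.exp r := by
    rw [Real.exp_eq_exp_ℝ, NormedSpace.exp_eq_tsum_div]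
  rw [he] at hprod
  have hz : ∀ z : ℕ, (Real.exp (-r) * (r : ℝ) ^ z / z.factorial) • laguerre z w =
      Real.exp (-r) * ∑ kl ∈ Finset.HasAntidiagonal.antidiagonal z,
        (-(w * r)) ^ kl.1 / (kl.1.factorial : ℝ) ^ 2 * ((r : ℝ) ^ kl.2 / kl.2.factorial) := by
    intro z
    rw [Finset.Nat.sum_antidiagonal_eq_sum_range_succ_mk, laguerre, smul_eq_mul, Finset.mul_sum,
      Finset.mul_sum]
    refine Finset.sum_congr rfl fun k hk => ?_
    have hkz : k ≤ z := Nat.lt_succ_iff.1 (Finset.mem_range.1 hk)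
    have hp : (r : ℝ) ^ z = r ^ k * r ^ (z - k) := by
      rw [← pow_add, Nat.add_sub_cancel' hkz]
    have hc : (z.choose k : ℝ) * k.factorial * (z - k).factorial = z.factorial := by
      exact_mod_cast Nat.choose_mul_factorial_mul_factorial hkz
    have hc' : (z.choose k : ℝ) = z.factorial / (k.factorial * (z - k).factorial) := by
      rw [← hc]
      field_simp
    rw [hp, hc', neg_pow (w * r), mul_pow]
    field_simp
  rw [integral_poissonMeasure, tsum_congr hz, tsum_mul_left, ← hprod, besselSeries, mul_comm,
    mul_assoc, ← Real.exp_add]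
  simp

open Filter Topology in
theorem le_of_forall_le_mul_exp {a b : ℝ} (h : ∀ w : ℝ, 0 < w → a ≤ b * Real.exp w) : a ≤ b := by
  have ht : Tendsto (fun w : ℝ => b * Real.exp w) (𝓝[>] 0) (𝓝 (b * Real.exp 0)) :=
    ((Real.continuous_exp.const_smul b).tendsto 0).mono_left nhdsWithin_le_nhds
  rw [Real.exp_zero, mul_one] at ht
  exact ge_of_tendsto ht (eventually_nhdsWithin_of_forall fun w hw => h w hw)

open MeasureTheory ProbabilityTheory in
theorem abs_besselSeries_le_one {x : ℝ} (hx : 0 ≤ x) : |besselSeries x| ≤ 1 := by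
  refine le_of_forall_le_mul_exp fun w hw => ?_
  set r : NNReal := ⟨x / w, by positivity⟩ with hr
  have hx' : x = w * (r : ℝ) := by
    change x = w * (x / w)
    field_simp
  rw [hx', ← integral_laguerre_poissonMeasure, one_mul]
  have h := norm_integral_le_of_norm_le_const (μ := poissonMeasure r) (f := fun z => laguerre z w)
    (C := Real.exp w) (Filter.Eventually.of_forall fun z => abs_laguerre_le z hw.le)
  simpa using h

open MeasureTheory ProbabilityTheory in
theorem abs_one_sub_besselSeries_le {x : ℝ} (hx : 0 ≤ x) : |1 - besselSeries x| ≤ 2 * √x := by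
  rcases hx.eq_or_lt with rfl | hx
  · have : besselSeries 0 = 1 := by
      have := integral_laguerre_poissonMeasure 0 0
      simpa using this.symm
    simp [this]
  refine le_of_forall_le_mul_exp fun w hw => ?_
  have hq0 : 0 < x / w := by positivity
  set r : NNReal := ⟨x / w, hq0.le⟩ with hr
  have hr' : (r : ℝ) = x / w := rfl
  have hr0 : (0 : ℝ) < r := hq0
  have hx' : x = w * (r : ℝ) := by
    rw [hr']
    field_simp
  have hsr : 0 < √(r : ℝ) := Real.sqrt_pos.2 hr0
  have hsr2 : √(r : ℝ) * √(r : ℝ) = r := Real.mul_self_sqrt hr0.le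
  have hZ : Integrable (fun z : ℕ => (z : ℝ)) (poissonMeasure r) := by
    simpa using integrable_natCast_pow_poissonMeasure r 1
  have h1 : 1 - besselSeries x = ∫ z, (1 - laguerre z w) ∂poissonMeasure r := by
    rw [integral_sub (integrable_const _) (integrable_laguerre_poissonMeasure r hw.le),
      integral_laguerre_poissonMeasure, ← hx']
    simp
  have hbound : ∀ z : ℕ, ‖1 - laguerre z w‖ ≤
      (√w * Real.exp w / √(r : ℝ)) * ((z : ℝ) + r) := by
    intro z
    refine (abs_one_sub_laguerre_le z hw.le).trans ?_
    have hz2 : √(z : ℝ) * √(z : ℝ) = z := Real.mul_self_sqrt (by positivity)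
    have : 2 * √(z : ℝ) * √(r : ℝ) ≤ z + r := by
      nlinarith [sq_nonneg (√(z : ℝ) - √(r : ℝ))]
    rw [div_mul_eq_mul_div, le_div_iff₀ hsr]
    nlinarith [mul_le_mul_of_nonneg_left this (by positivity : 0 ≤ √w * Real.exp w)]
  have h2 := norm_integral_le_of_norm_le ((hZ.add (integrable_const (r : ℝ))).const_mul _)
    (Filter.Eventually.of_forall hbound)
  rw [h1]
  refine (le_of_eq_of_le (Real.norm_eq_abs _).symm h2).trans (le_of_eq ?_)
  rw [integral_const_mul]
  simp only [Pi.add_apply]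
  rw [integral_add hZ (integrable_const _), integral_natCast_poissonMeasure, hx',
    Real.sqrt_mul hw.le]
  simp only [integral_const, probReal_univ, smul_eq_mul, one_mul]
  rw [← hsr2]
  field_simp
  rw [Real.sqrt_sq hsr.le]
  ring

open MeasureTheory in
theorem integrableOn_Ioc_rpow {a : ℝ} (ha : -1 < a) {W : ℝ} (hW : 0 ≤ W) :
    IntegrableOn (fun w : ℝ => w ^ a) (Set.Ioc 0 W) := by
  rw [← intervalIntegrable_iff_integrableOn_Ioc_of_le hW]
  exact intervalIntegral.intervalIntegrable_rpow' ha

open MeasureTheory in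
theorem integral_Ioc_rpow {a : ℝ} (ha : -1 < a) {W : ℝ} (hW : 0 ≤ W) :
    ∫ w in Set.Ioc 0 W, w ^ a = W ^ (a + 1) / (a + 1) := by
  rw [← intervalIntegral.integral_of_le hW, integral_rpow (Or.inl ha),
    Real.zero_rpow (by linarith), sub_zero]

theorem sqrt_mul_rpow_neg {w : ℝ} (hw : 0 < w) (s : ℝ) :
    √w * w ^ (-1 - s) = w ^ (-1 / 2 - s) := by
  rw [Real.sqrt_eq_rpow, ← Real.rpow_add hw]
  congr 1
  ring

open MeasureTheory in
/-- Integrability, and a bound on the integral, against the kernel `w ^ (-1 - s)` near zero of a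
function which is `O(√w)`. -/
theorem integrableOn_mul_rpow_of_abs_le_sqrt {s : ℝ} (hs : s < 1 / 2) {W B : ℝ} (hW : 0 ≤ W)
    (hB : 0 ≤ B) {g : ℝ → ℝ} (hg : Measurable g)
    (hgb : ∀ w, 0 < w → |g w| ≤ B * (√w * Real.exp w)) :
    IntegrableOn (fun w => g w * w ^ (-1 - s)) (Set.Ioc 0 W) ∧
      |∫ w in Set.Ioc 0 W, g w * w ^ (-1 - s)| ≤
        B * (Real.exp W * (W ^ (1 / 2 - s) / (1 / 2 - s))) := by
  have ha : -1 < -1 / 2 - s := by linarith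
  have hdom := (integrableOn_Ioc_rpow ha hW).const_mul (B * Real.exp W)
  have hbound : ∀ w ∈ Set.Ioc 0 W, ‖g w * w ^ (-1 - s)‖ ≤
      B * Real.exp W * w ^ (-1 / 2 - s) := by
    intro w hw
    have hw0 : 0 < w := hw.1
    have hp : 0 < w ^ (-1 - s) := Real.rpow_pos_of_pos hw0 _
    rw [Real.norm_eq_abs, abs_mul, abs_of_pos hp, ← sqrt_mul_rpow_neg hw0]
    calc |g w| * w ^ (-1 - s) ≤ B * (√w * Real.exp w) * w ^ (-1 - s) := by
          gcongr
          exact hgb w hw0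
      _ ≤ B * (√w * Real.exp W) * w ^ (-1 - s) := by
          gcongr
          exact hw.2
      _ = B * Real.exp W * (√w * w ^ (-1 - s)) := by ring
  have hae : ∀ᵐ w ∂(volume.restrict (Set.Ioc 0 W)), ‖g w * w ^ (-1 - s)‖ ≤
      B * Real.exp W * w ^ (-1 / 2 - s) :=
    (ae_restrict_iff' measurableSet_Ioc).2 (Filter.Eventually.of_forall hbound)
  refine ⟨Integrable.mono' hdom (by fun_prop) hae, ?_⟩
  have h := norm_integral_le_of_norm_le hdom hae
  rw [integral_const_mul, integral_Ioc_rpow ha hW] at h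
  refine h.trans (le_of_eq ?_)
  rw [show -1 / 2 - s + 1 = 1 / 2 - s by ring]
  ring

open MeasureTheory in
theorem integrableOn_Ioi_besselSeries {s : ℝ} (hs : 0 < s) {W r : ℝ} (hW : 0 < W) (hr : 0 ≤ r) :
    IntegrableOn (fun w => besselSeries (w * r) * w ^ (-1 - s)) (Set.Ioi W) ∧
      |∫ w in Set.Ioi W, besselSeries (w * r) * w ^ (-1 - s)| ≤ W ^ (-s) / s := by
  have ha : -1 - s < -1 := by linarith
  have hdom := integrableOn_Ioi_rpow_of_lt ha hW
  have hmeas : Measurable fun w => besselSeries (w * r) * w ^ (-1 - s) :=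
    (measurable_besselSeries.comp (by fun_prop)).mul (by fun_prop)
  have hae : ∀ᵐ w ∂(volume.restrict (Set.Ioi W)), ‖besselSeries (w * r) * w ^ (-1 - s)‖ ≤
      w ^ (-1 - s) := by
    refine (ae_restrict_iff' measurableSet_Ioi).2 (Filter.Eventually.of_forall fun w hw => ?_)
    have hw0 : 0 < w := hW.trans hw
    have hp : 0 < w ^ (-1 - s) := Real.rpow_pos_of_pos hw0 _
    rw [Real.norm_eq_abs, abs_mul, abs_of_pos hp]
    exact mul_le_of_le_one_left hp.le (abs_besselSeries_le_one (by positivity))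
  refine ⟨Integrable.mono' hdom hmeas.aestronglyMeasurable hae, ?_⟩
  have h := norm_integral_le_of_norm_le hdom hae
  rw [integral_Ioi_rpow_of_lt ha hW] at h
  refine h.trans (le_of_eq ?_)
  rw [show -1 - s + 1 = -s by ring, neg_div_neg_eq]

open MeasureTheory in
theorem integrableOn_Ioc_one_sub_besselSeries {s : ℝ} (hs : s < 1 / 2) {W r : ℝ}
    (hW : 0 ≤ W) (hr : 0 ≤ r) :
    IntegrableOn (fun w => (1 - besselSeries (w * r)) * w ^ (-1 - s)) (Set.Ioc 0 W) := by
  refine (integrableOn_mul_rpow_of_abs_le_sqrt hs hW (B := 2 * √r) (by positivity)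
    (measurable_const.sub (measurable_besselSeries.comp (by fun_prop))) fun w hw => ?_).1
  have h := abs_one_sub_besselSeries_le (x := w * r) (by positivity)
  have he : 1 ≤ Real.exp w := Real.one_le_exp hw.le
  have hq : 0 ≤ √w * √r := by positivity
  rw [Real.sqrt_mul hw.le] at h
  refine h.trans ?_
  nlinarith

open MeasureTheory in
theorem integrableOn_Ioi_one_sub_besselSeries {s : ℝ} (hs0 : 0 < s) {W r : ℝ}
    (hW : 0 < W) (hr : 0 ≤ r) :
    IntegrableOn (fun w => (1 - besselSeries (w * r)) * w ^ (-1 - s)) (Set.Ioi W) := by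
  have h := (integrableOn_Ioi_rpow_of_lt (by linarith : -1 - s < -1) hW).sub
    (integrableOn_Ioi_besselSeries hs0 hW hr).1
  refine h.congr (Filter.Eventually.of_forall fun w => ?_)
  simp only [Pi.sub_apply]
  ring

theorem besselSeries_lt_one {w : ℝ} (hw0 : 0 < w) (hw : w < 1 / 2) : besselSeries w < 1 := by
  have hs := (summable_norm_besselSeries w).of_norm
  have h1 := hs.sum_add_tsum_nat_add 2
  have h2 : ‖∑' k : ℕ, (-w) ^ (k + 2) / ((k + 2).factorial : ℝ) ^ 2‖ ≤ w ^ 2 * 2 := by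
    refine tsum_of_norm_bounded (hasSum_geometric_two.mul_left (w ^ 2)) fun k => ?_
    have hf : (1 : ℝ) ≤ ((k + 2).factorial : ℝ) ^ 2 :=
      one_le_pow₀ (by exact_mod_cast (k + 2).factorial_pos)
    rw [norm_div, norm_pow, norm_neg, Real.norm_eq_abs, Real.norm_eq_abs, abs_of_pos hw0,
      abs_of_pos (by positivity)]
    refine (div_le_self (by positivity) hf).trans ?_
    rw [pow_add, mul_comm]
    gcongr
  rw [← besselSeries] at h1
  simp only [Finset.sum_range_succ, Finset.sum_range_zero] at h1
  norm_num at h1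
  have h3 := (abs_le.1 h2).2
  nlinarith

/-- The normalizing constant of the representation
`r ^ s = C⁻¹ ∫ (1 - J₀(2 √(w r))) w ^ (-1 - s) dw`. -/
noncomputable def besselConst (s : ℝ) : ℝ :=
  ∫ w in Set.Ioi (0 : ℝ), (1 - besselSeries w) * w ^ (-1 - s)

open MeasureTheory in
theorem besselConst_pos {s : ℝ} (hs0 : 0 < s) (hs : s < 1 / 2) : 0 < besselConst s := by
  have hInt : IntegrableOn (fun w => (1 - besselSeries w) * w ^ (-1 - s)) (Set.Ioi 0) := by
    rw [← Set.Ioc_union_Ioi_eq_Ioi zero_le_one]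
    have h1 := integrableOn_Ioc_one_sub_besselSeries hs zero_le_one zero_le_one
    have h2 := integrableOn_Ioi_one_sub_besselSeries hs0 zero_lt_one zero_le_one
    simp only [mul_one] at h1 h2
    exact h1.union h2
  rw [besselConst, setIntegral_pos_iff_support_of_nonneg_ae _ hInt]
  · refine lt_of_lt_of_le ?_ (measure_mono (s := Set.Ioo (0 : ℝ) (1 / 2)) fun w hw => ?_)
    · simp
    · have h1 := besselSeries_lt_one hw.1 hw.2
      have h2 := Real.rpow_pos_of_pos hw.1 (-1 - s)
      exact ⟨(mul_pos (by linarith) h2).ne', hw.1⟩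
  · refine (ae_restrict_iff' measurableSet_Ioi).2 (Filter.Eventually.of_forall fun w hw => ?_)
    have h1 := (abs_le.1 (abs_besselSeries_le_one (le_of_lt hw))).2
    have h2 := Real.rpow_pos_of_pos hw (-1 - s)
    exact mul_nonneg (by linarith) h2.le

open MeasureTheory in
theorem integral_Ioi_one_sub_besselSeries (s : ℝ) {r : ℝ} (hr : 0 < r) :
    ∫ w in Set.Ioi (0 : ℝ), (1 - besselSeries (w * r)) * w ^ (-1 - s) = r ^ s * besselConst s := by
  have h := integral_comp_mul_left_Ioi (fun x => (1 - besselSeries x) * x ^ (-1 - s)) 0 hr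
  rw [mul_zero, ← besselConst] at h
  have h2 : ∫ w in Set.Ioi (0 : ℝ), (1 - besselSeries (r * w)) * (r * w) ^ (-1 - s) =
      r ^ (-1 - s) * ∫ w in Set.Ioi (0 : ℝ), (1 - besselSeries (w * r)) * w ^ (-1 - s) := by
    rw [← integral_const_mul]
    refine setIntegral_congr_fun measurableSet_Ioi fun w hw => ?_
    rw [Real.mul_rpow hr.le (le_of_lt hw), mul_comm r w]
    ring
  rw [h2] at h
  have hp : r ^ (-1 - s) * r ^ s = r⁻¹ := by
    rw [← Real.rpow_add hr, ← Real.rpow_neg_one]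
    congr 1
    ring
  have hne : r ^ (-1 - s) ≠ 0 := (Real.rpow_pos_of_pos hr _).ne'
  refine mul_left_cancel₀ hne ?_
  rw [h, ← mul_assoc, hp, smul_eq_mul]

/-- The integral of `1 - laguerre z` over `(0, W]` against `w ^ (-1 - s)`. -/
noncomputable def laguerreIntegral (s W : ℝ) (z : ℕ) : ℝ :=
  ∫ w in Set.Ioc 0 W, (1 - laguerre z w) * w ^ (-1 - s)

open MeasureTheory in
theorem integrableOn_one_sub_laguerre {s : ℝ} (hs : s < 1 / 2) {W : ℝ} (hW : 0 ≤ W) (z : ℕ) :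
    IntegrableOn (fun w => (1 - laguerre z w) * w ^ (-1 - s)) (Set.Ioc 0 W) :=
  (integrableOn_mul_rpow_of_abs_le_sqrt hs hW (by positivity)
    (measurable_const.sub (continuous_laguerre z).measurable)
    fun _ hw => abs_one_sub_laguerre_le z hw.le).1

theorem abs_laguerreIntegral_le {s : ℝ} (hs : s < 1 / 2) {W : ℝ} (hW : 0 ≤ W) (z : ℕ) :
    |laguerreIntegral s W z| ≤ 2 * √z * (Real.exp W * (W ^ (1 / 2 - s) / (1 / 2 - s))) :=
  (integrableOn_mul_rpow_of_abs_le_sqrt hs hW (by positivity)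
    (measurable_const.sub (continuous_laguerre z).measurable)
    fun _ hw => abs_one_sub_laguerre_le z hw.le).2

open MeasureTheory in
theorem abs_laguerreIntegral_succ_sub_le {s : ℝ} (hs : s < 1 / 2) {W : ℝ} (hW : 0 ≤ W) (z : ℕ) :
    (z + 1) * |laguerreIntegral s W (z + 1) - laguerreIntegral s W z| ≤
      √(z + 1) * (Real.exp W * (W ^ (1 / 2 - s) / (1 / 2 - s))) := by
  have h := (integrableOn_mul_rpow_of_abs_le_sqrt hs hW (B := √((z : ℝ) + 1)) (by positivity)
    (g := fun w => ((z : ℝ) + 1) * (laguerre z w - laguerre (z + 1) w))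
    (((continuous_laguerre z).measurable.sub (continuous_laguerre (z + 1)).measurable).const_mul _)
    fun w hw => by
      rw [abs_mul, abs_of_nonneg (by positivity : (0 : ℝ) ≤ z + 1), abs_sub_comm]
      exact abs_laguerre_succ_sub_le z hw.le).2
  have he : ∫ w in Set.Ioc 0 W,
      ((z : ℝ) + 1) * (laguerre z w - laguerre (z + 1) w) * w ^ (-1 - s) =
      ((z : ℝ) + 1) * (laguerreIntegral s W (z + 1) - laguerreIntegral s W z) := by
    rw [laguerreIntegral, laguerreIntegral, ← integral_sub
      (integrableOn_one_sub_laguerre hs hW (z + 1)) (integrableOn_one_sub_laguerre hs hW z),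
      ← integral_const_mul]
    congr 1
    ext w
    ring
  rwa [he, abs_mul, abs_of_nonneg (by positivity : (0 : ℝ) ≤ z + 1)] at h

theorem sqrt_natCast_le_exp (z : ℕ) : √(z : ℝ) ≤ Real.exp z := by
  have h := Real.add_one_le_exp (z : ℝ)
  rw [Real.sqrt_le_left (Real.exp_pos _).le]
  have : (0 : ℝ) ≤ z := by positivity
  nlinarith

open MeasureTheory ProbabilityTheory in
theorem integral_laguerreIntegral {s : ℝ} (hs : s < 1 / 2) {W : ℝ} (hW : 0 ≤ W) (r : NNReal) :
    ∫ z, laguerreIntegral s W z ∂poissonMeasure r =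
      ∫ w in Set.Ioc 0 W, (1 - besselSeries (w * r)) * w ^ (-1 - s) := by
  set p : ℕ → ℝ := fun z => Real.exp (-r) * (r : ℝ) ^ z / z.factorial with hp
  have hp0 : ∀ z, 0 ≤ p z := fun z => by simp only [hp]; positivity
  set F : ℕ → ℝ → ℝ := fun z w => p z * ((1 - laguerre z w) * w ^ (-1 - s)) with hF
  set D : ℝ := Real.exp W * (W ^ (1 / 2 - s) / (1 / 2 - s)) with hD
  have hD0 : 0 ≤ D := by
    have : 0 < 1 / 2 - s := by linarith
    positivity
  have hnorm : ∀ z, ∫ w in Set.Ioc 0 W, ‖F z w‖ ≤ p z * (2 * √z * D) := by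
    intro z
    have h := (integrableOn_mul_rpow_of_abs_le_sqrt hs hW (B := 2 * √(z : ℝ)) (by positivity)
      (g := fun w => |1 - laguerre z w|)
      (measurable_const.sub (continuous_laguerre z).measurable).norm
      fun w hw => by
        rw [abs_abs]
        exact abs_one_sub_laguerre_le z hw.le).2
    have he : ∫ w in Set.Ioc 0 W, ‖F z w‖ =
        p z * ∫ w in Set.Ioc 0 W, |1 - laguerre z w| * w ^ (-1 - s) := by
      rw [← integral_const_mul]
      refine setIntegral_congr_fun measurableSet_Ioc fun w hw => ?_
      simp only [hF]
      rw [norm_mul, norm_mul, Real.norm_of_nonneg (hp0 z), Real.norm_eq_abs,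
        Real.norm_of_nonneg (Real.rpow_pos_of_pos hw.1 _).le]
    rw [he]
    exact mul_le_mul_of_nonneg_left ((le_abs_self _).trans h) (hp0 z)
  have hsum : Summable fun z => ∫ w in Set.Ioc 0 W, ‖F z w‖ := by
    refine Summable.of_nonneg_of_le (fun z => integral_nonneg fun w => norm_nonneg _) hnorm ?_
    have hi : Integrable (fun z : ℕ => 2 * √(z : ℝ) * D) (poissonMeasure r) := by
      refine integrable_poissonMeasure_of_abs_le_exp r (C := 2 * D) fun z => ?_
      rw [abs_of_nonneg (by positivity)]
      nlinarith [sqrt_natCast_le_exp z]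
    refine (integrable_poissonMeasure_iff.1 hi).congr fun z => ?_
    rw [Real.norm_of_nonneg (by positivity)]
  have h := hasSum_integral_of_summable_integral_norm
    (fun z => (integrableOn_one_sub_laguerre hs hW z).const_mul (p z)) hsum
  rw [integral_poissonMeasure]
  have h2 : ∀ z, ∫ w in Set.Ioc 0 W, F z w = p z • laguerreIntegral s W z := fun z => by
    rw [hF, laguerreIntegral, integral_const_mul, smul_eq_mul]
  rw [← tsum_congr h2, h.tsum_eq]
  refine setIntegral_congr_fun measurableSet_Ioc fun w hw => ?_
  have hi := integrable_laguerre_poissonMeasure r hw.1.le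
  have h3 := integral_sub (integrable_const (1 : ℝ)) hi
  rw [integral_laguerre_poissonMeasure, integral_poissonMeasure] at h3
  simp only [integral_const, probReal_univ, smul_eq_mul, one_mul] at h3
  rw [← h3, ← tsum_mul_right]
  exact tsum_congr fun z => by rw [mul_assoc]

/-- An estimator of `r ^ s` from a Poisson observation of mean `r`. -/
noncomputable def powerEstimator (s W : ℝ) (z : ℕ) : ℝ :=
  (besselConst s)⁻¹ * (laguerreIntegral s W z + W ^ (-s) / s)

open MeasureTheory ProbabilityTheory in
theorem integrable_laguerreIntegral {s : ℝ} (hs : s < 1 / 2) {W : ℝ} (hW : 0 ≤ W) (r : NNReal) :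
    Integrable (laguerreIntegral s W) (poissonMeasure r) := by
  have h1 : 0 < 1 / 2 - s := by linarith
  refine integrable_poissonMeasure_of_abs_le_exp r
    (C := 2 * (Real.exp W * (W ^ (1 / 2 - s) / (1 / 2 - s)))) fun z => ?_
  refine (abs_laguerreIntegral_le hs hW z).trans ?_
  have hD0 : 0 ≤ Real.exp W * (W ^ (1 / 2 - s) / (1 / 2 - s)) := by positivity
  nlinarith [sqrt_natCast_le_exp z]

open MeasureTheory ProbabilityTheory in
theorem abs_integral_powerEstimator_sub_le {s : ℝ} (hs0 : 0 < s) (hs : s < 1 / 2) {W : ℝ}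
    (hW : 0 < W) {r : NNReal} (hr : 0 < r) :
    |∫ z, powerEstimator s W z ∂poissonMeasure r - (r : ℝ) ^ s| ≤
      (besselConst s)⁻¹ * (W ^ (-s) / s) := by
  have hK := besselConst_pos hs0 hs
  have hr' : (0 : ℝ) < r := hr
  have h1 : ∫ z, powerEstimator s W z ∂poissonMeasure r = (besselConst s)⁻¹ *
      ((∫ w in Set.Ioc 0 W, (1 - besselSeries (w * r)) * w ^ (-1 - s)) + W ^ (-s) / s) := by
    unfold powerEstimator
    rw [integral_const_mul, integral_add (integrable_laguerreIntegral hs hW.le r)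
      (integrable_const _), integral_laguerreIntegral hs hW.le]
    simp
  have h2 := integral_Ioi_one_sub_besselSeries s hr'
  have hA := integrableOn_Ioc_one_sub_besselSeries hs hW.le hr'.le
  have hB := integrableOn_Ioi_one_sub_besselSeries hs0 hW hr'.le
  rw [← Set.Ioc_union_Ioi_eq_Ioi hW.le,
    setIntegral_union Set.Ioc_disjoint_Ioi_same measurableSet_Ioi hA hB] at h2
  have h3 : ∫ w in Set.Ioi W, (1 - besselSeries (w * r)) * w ^ (-1 - s) =
      W ^ (-s) / s - ∫ w in Set.Ioi W, besselSeries (w * r) * w ^ (-1 - s) := by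
    have ha : -1 - s < -1 := by linarith
    have h4 : W ^ (-s) / s = ∫ w in Set.Ioi W, w ^ (-1 - s) := by
      rw [integral_Ioi_rpow_of_lt ha hW, show -1 - s + 1 = -s by ring, neg_div_neg_eq]
    rw [h4, ← integral_sub (integrableOn_Ioi_rpow_of_lt ha hW)
      (integrableOn_Ioi_besselSeries hs0 hW hr'.le).1]
    congr 1
    ext w
    ring
  have h5 : (r : ℝ) ^ s = (besselConst s)⁻¹ * ((r : ℝ) ^ s * besselConst s) := by
    field_simp
  rw [h1, h5, ← h2, h3, ← mul_sub, abs_mul, abs_of_pos (inv_pos.2 hK)]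
  refine mul_le_mul_of_nonneg_left ?_ (inv_pos.2 hK).le
  refine le_of_eq_of_le (congrArg abs ?_) (integrableOn_Ioi_besselSeries hs0 hW hr'.le).2
  ring

/-- The constant governing the oscillation of `powerEstimator`. -/
noncomputable def oscillationConst (s : ℝ) : ℝ :=
  (besselConst s)⁻¹ * (3 / (1 / 2 - s) + 1 / s)

theorem oscillationConst_pos {s : ℝ} (hs0 : 0 < s) (hs : s < 1 / 2) : 0 < oscillationConst s := by
  have := besselConst_pos hs0 hs
  have h1 : 0 < 1 / 2 - s := by linarith
  unfold oscillationConst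
  positivity

theorem exp_mul_rpow_le {s : ℝ} (hs0 : 0 < s) (hs : s < 1 / 2) {W : ℝ} (hW : 1 ≤ W) :
    Real.exp W * (W ^ (1 / 2 - s) / (1 / 2 - s)) ≤ Real.exp (2 * W) * (1 / (1 / 2 - s)) := by
  have h1 : 0 < 1 / 2 - s := by linarith
  have h2 : W ^ (1 / 2 - s) ≤ Real.exp W := by
    calc W ^ (1 / 2 - s) ≤ W ^ (1 : ℝ) := Real.rpow_le_rpow_of_exponent_le hW (by linarith)
      _ = W := Real.rpow_one W
      _ ≤ Real.exp W := by linarith [Real.add_one_le_exp W]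
  calc Real.exp W * (W ^ (1 / 2 - s) / (1 / 2 - s))
      ≤ Real.exp W * (Real.exp W / (1 / 2 - s)) := by gcongr
    _ = Real.exp (2 * W) * (1 / (1 / 2 - s)) := by
      rw [two_mul, Real.exp_add]
      ring

theorem rpow_neg_div_le {s : ℝ} (hs0 : 0 < s) {W : ℝ} (hW : 1 ≤ W) :
    W ^ (-s) / s ≤ Real.exp (2 * W) * (1 / s) := by
  have h1 : W ^ (-s) ≤ 1 := Real.rpow_le_one_of_one_le_of_nonpos hW (by linarith)
  have h2 : 1 ≤ Real.exp (2 * W) := Real.one_le_exp (by linarith)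
  calc W ^ (-s) / s ≤ Real.exp (2 * W) / s := by gcongr; linarith
    _ = _ := by ring

theorem abs_powerEstimator_le {s : ℝ} (hs0 : 0 < s) (hs : s < 1 / 2) {W : ℝ} (hW : 1 ≤ W)
    (z : ℕ) :
    |powerEstimator s W z| ≤
      (besselConst s)⁻¹ * ((2 / (1 / 2 - s) + 1 / s) * Real.exp (2 * W) * √(z + 1)) := by
  have hK := besselConst_pos hs0 hs
  have h1 : 0 < 1 / 2 - s := by linarith
  rw [powerEstimator, abs_mul, abs_of_pos (inv_pos.2 hK)]
  refine mul_le_mul_of_nonneg_left ?_ (inv_pos.2 hK).le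
  have ha := abs_laguerreIntegral_le hs (by linarith : 0 ≤ W) z
  have hb := exp_mul_rpow_le hs0 hs hW
  have hc := rpow_neg_div_le hs0 hW
  have hd : √(z : ℝ) ≤ √((z : ℝ) + 1) := Real.sqrt_le_sqrt (by linarith)
  have he : 1 ≤ √((z : ℝ) + 1) := Real.one_le_sqrt.2 (by linarith [(Nat.cast_nonneg z : (0:ℝ) ≤ z)])
  have hW0 : 0 < W := by linarith
  calc |laguerreIntegral s W z + W ^ (-s) / s|
      ≤ |laguerreIntegral s W z| + |W ^ (-s) / s| := abs_add_le _ _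
    _ ≤ 2 * √(z + 1) * (Real.exp (2 * W) * (1 / (1 / 2 - s))) +
        Real.exp (2 * W) * (1 / s) * √(z + 1) := by
      rw [abs_of_pos (by positivity : 0 < W ^ (-s) / s)]
      refine add_le_add (ha.trans ?_) (hc.trans (le_mul_of_one_le_right (by positivity) he))
      gcongr
    _ = _ := by ring

theorem abs_mul_powerEstimator_succ_sub_le {s : ℝ} (hs0 : 0 < s) (hs : s < 1 / 2) {W : ℝ}
    (hW : 1 ≤ W) (z : ℕ) :
    |((z + 1 : ℕ) : ℝ) * powerEstimator s W (z + 1 - 1) - z * powerEstimator s W (z - 1)| ≤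
      oscillationConst s * Real.exp (2 * W) * √(z + 1) := by
  have hK := inv_pos.2 (besselConst_pos hs0 hs)
  have h1 : 0 < 1 / 2 - s := by linarith
  have hf := abs_powerEstimator_le hs0 hs hW z
  have hdiff : |(z : ℝ) * (powerEstimator s W z - powerEstimator s W (z - 1))| ≤
      (besselConst s)⁻¹ * (1 / (1 / 2 - s) * Real.exp (2 * W) * √(z + 1)) := by
    rcases z with _ | z
    · simp only [Nat.cast_zero, zero_mul, abs_zero]
      positivity
    · have h2 := abs_laguerreIntegral_succ_sub_le hs (by linarith : 0 ≤ W) z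
      have hb := exp_mul_rpow_le hs0 hs hW
      simp only [Nat.add_sub_cancel, powerEstimator]
      rw [← mul_sub, add_sub_add_right_eq_sub, abs_mul, abs_mul, abs_of_pos hK]
      push_cast
      rw [abs_of_pos (by positivity : (0 : ℝ) < z + 1)]
      calc ((z : ℝ) + 1) * ((besselConst s)⁻¹ *
            |laguerreIntegral s W (z + 1) - laguerreIntegral s W z|)
          = (besselConst s)⁻¹ * (((z : ℝ) + 1) *
            |laguerreIntegral s W (z + 1) - laguerreIntegral s W z|) := by ring
        _ ≤ (besselConst s)⁻¹ * (√((z : ℝ) + 1 + 1) *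
            (Real.exp (2 * W) * (1 / (1 / 2 - s)))) := by
          refine mul_le_mul_of_nonneg_left (h2.trans ?_) hK.le
          have hd : √((z : ℝ) + 1) ≤ √((z : ℝ) + 1 + 1) := Real.sqrt_le_sqrt (by linarith)
          have hW0 : 0 < W := by linarith
          gcongr
        _ = _ := by ring
  have he : ((z + 1 : ℕ) : ℝ) * powerEstimator s W (z + 1 - 1) - z * powerEstimator s W (z - 1) =
      powerEstimator s W z + z * (powerEstimator s W z - powerEstimator s W (z - 1)) := by
    rw [Nat.add_sub_cancel]
    push_cast
    ring
  rw [he]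
  refine (abs_add_le _ _).trans ((add_le_add hf hdiff).trans (le_of_eq ?_))
  rw [oscillationConst]
  ring

theorem abs_sub_le_of_abs_succ_sub_le {A : ℕ → ℝ} {B : ℝ} (hB : 0 ≤ B)
    (hA : ∀ z : ℕ, |A (z + 1) - A z| ≤ B * √(z + 1)) {m z : ℕ} (hmz : m ≤ z) :
    |A z - A m| ≤ B * ((z - m) * √z) := by
  induction z, hmz using Nat.le_induction with
  | base => simp
  | succ z hmz ih =>
    have hm : (m : ℝ) ≤ z := by exact_mod_cast hmz
    have hd : √(z : ℝ) ≤ √((z : ℝ) + 1) := Real.sqrt_le_sqrt (by linarith)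
    push_cast
    calc |A (z + 1) - A m| ≤ |A (z + 1) - A z| + |A z - A m| := abs_sub_le _ _ _
      _ ≤ B * √(z + 1) + B * ((z - m) * √(z + 1)) := by
        refine add_le_add (hA z) (ih.trans ?_)
        have : 0 ≤ (z : ℝ) - m := by linarith
        gcongr
      _ = _ := by ring

theorem sq_sub_le_of_abs_succ_sub_le {A : ℕ → ℝ} {B : ℝ} (hB : 0 ≤ B)
    (hA : ∀ z : ℕ, |A (z + 1) - A z| ≤ B * √(z + 1)) (m z : ℕ) :
    (A z - A m) ^ 2 ≤ B ^ 2 * ((z - m) ^ 2 * (z + m)) := by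
  wlog hmz : m ≤ z generalizing m z
  · have h := this z m (le_of_not_ge hmz)
    calc (A z - A m) ^ 2 = (A m - A z) ^ 2 := by ring
      _ ≤ _ := h
      _ = _ := by ring
  have h := abs_sub_le_of_abs_succ_sub_le hB hA hmz
  calc (A z - A m) ^ 2 = |A z - A m| ^ 2 := (sq_abs _).symm
    _ ≤ (B * ((z - m) * √z)) ^ 2 := by gcongr
    _ = B ^ 2 * ((z - m) ^ 2 * z) := by
      rw [mul_pow, mul_pow, Real.sq_sqrt (Nat.cast_nonneg z)]
    _ ≤ _ := by
      gcongr
      simp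

open MeasureTheory ProbabilityTheory in
theorem integrable_cubic_poissonMeasure (r : NNReal) (m : ℕ) :
    Integrable (fun z : ℕ => ((z : ℝ) - m) ^ 2 * (z + m)) (poissonMeasure r) ∧
      ∫ z : ℕ, ((z : ℝ) - m) ^ 2 * (z + m) ∂poissonMeasure r =
        ((r : ℝ) - m) ^ 2 * (r + m) + 3 * r ^ 2 + r - m * r := by
  have h1 := integrable_natCast_pow_poissonMeasure r 1
  have h2 := integrable_natCast_pow_poissonMeasure r 2
  have h3 := integrable_natCast_pow_poissonMeasure r 3
  simp only [pow_one] at h1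
  have he : (fun z : ℕ => ((z : ℝ) - m) ^ 2 * (z + m)) =
      fun z : ℕ => (z : ℝ) ^ 3 - m * (z : ℝ) ^ 2 - (m : ℝ) ^ 2 * z + (m : ℝ) ^ 3 := by
    ext z
    ring
  have h4 := (h3.sub (h2.const_mul (m : ℝ)))
  have h5 := h4.sub (h1.const_mul ((m : ℝ) ^ 2))
  simp only [Pi.sub_def] at h4 h5
  rw [he]
  refine ⟨h5.add (integrable_const _), ?_⟩
  rw [integral_add h5 (integrable_const _), integral_sub h4 (h1.const_mul _),
    integral_sub h3 (h2.const_mul _), integral_const_mul, integral_const_mul,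
    integral_natCast_poissonMeasure, integral_natCast_sq_poissonMeasure,
    integral_natCast_cube_poissonMeasure]
  simp only [integral_const, probReal_univ, smul_eq_mul, one_mul]
  ring

open MeasureTheory ProbabilityTheory in
theorem memLp_two_poissonMeasure_of_abs_succ_sub_le {A : ℕ → ℝ} {B : ℝ} (hB : 0 ≤ B)
    (hA : ∀ z : ℕ, |A (z + 1) - A z| ≤ B * √(z + 1)) (r : NNReal) :
    MemLp A 2 (poissonMeasure r) := by
  have h : MemLp (fun z => A z - A 0) 2 (poissonMeasure r) := by
    rw [memLp_two_iff_integrable_sq (measurable_of_countable _).aestronglyMeasurable]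
    refine Integrable.mono' ((integrable_cubic_poissonMeasure r 0).1.const_mul (B ^ 2))
      (measurable_of_countable _).aestronglyMeasurable (Filter.Eventually.of_forall fun z => ?_)
    rw [Real.norm_of_nonneg (sq_nonneg _)]
    exact sq_sub_le_of_abs_succ_sub_le hB hA 0 z
  simpa [Pi.add_def] using h.add (memLp_const (A 0))

open MeasureTheory ProbabilityTheory in
/-- A Poincaré-type variance bound for functions of a Poisson variable whose increments
are `O(√z)`. -/
theorem variance_poissonMeasure_le {A : ℕ → ℝ} {B : ℝ} (hB : 0 ≤ B)
    (hA : ∀ z : ℕ, |A (z + 1) - A z| ≤ B * √(z + 1)) (r : NNReal) :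
    Var[A; poissonMeasure r] ≤ 3 * B ^ 2 * ((r : ℝ) ^ 2 + r) := by
  set m := ⌊(r : ℝ)⌋₊ with hm
  have hr : (0 : ℝ) ≤ r := r.2
  have hm1 : (m : ℝ) ≤ r := Nat.floor_le hr
  have hm2 : (r : ℝ) < m + 1 := Nat.lt_floor_add_one _
  have hm0 : (0 : ℝ) ≤ m := Nat.cast_nonneg m
  have hc := integrable_cubic_poissonMeasure r m
  have hmeas : AEStronglyMeasurable A (poissonMeasure r) :=
    (measurable_of_countable _).aestronglyMeasurable
  rw [← variance_sub_const hmeas (A m)]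
  refine (variance_le_expectation_sq (measurable_of_countable _).aestronglyMeasurable).trans ?_
  calc ∫ z, ((fun z => A z - A m) ^ 2) z ∂poissonMeasure r
      ≤ ∫ z : ℕ, B ^ 2 * (((z : ℝ) - m) ^ 2 * (z + m)) ∂poissonMeasure r := by
        refine integral_mono_of_nonneg (Filter.Eventually.of_forall fun z => sq_nonneg _)
          (hc.1.const_mul _) (Filter.Eventually.of_forall fun z => ?_)
        exact sq_sub_le_of_abs_succ_sub_le hB hA m z
    _ = B ^ 2 * (((r : ℝ) - m) ^ 2 * (r + m) + 3 * r ^ 2 + r - m * r) := by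
        rw [integral_const_mul, hc.2]
    _ ≤ B ^ 2 * (3 * ((r : ℝ) ^ 2 + r)) := by
        refine mul_le_mul_of_nonneg_left ?_ (sq_nonneg B)
        have h1 : ((r : ℝ) - m) ^ 2 ≤ 1 := by nlinarith
        have h2 : ((r : ℝ) - m) ^ 2 * (r + m) ≤ 1 * (r + m) := by gcongr
        nlinarith [mul_nonneg hm0 hr]
    _ = _ := by ring

/-- An estimator of `r ^ (1 + s)` from a Poisson observation of mean `r`. -/
noncomputable def powerSumTerm (s W : ℝ) (z : ℕ) : ℝ :=
  z * powerEstimator s W (z - 1)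

open MeasureTheory ProbabilityTheory in
theorem abs_integral_powerSumTerm_sub_le {s : ℝ} (hs0 : 0 < s) (hs : s < 1 / 2) {W : ℝ}
    (hW : 1 ≤ W) (r : NNReal) :
    |∫ z, powerSumTerm s W z ∂poissonMeasure r - (r : ℝ) ^ (1 + s)| ≤
      r * ((besselConst s)⁻¹ * (W ^ (-s) / s)) := by
  have hK := inv_pos.2 (besselConst_pos hs0 hs)
  have h1 : 0 < 1 / 2 - s := by linarith
  have h := (integral_poissonMeasure_mul_pred r (h := powerEstimator s W)
    (C := (besselConst s)⁻¹ * ((2 / (1 / 2 - s) + 1 / s) * Real.exp (2 * W))) fun z => ?_).2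
  · unfold powerSumTerm
    rw [h]
    rcases eq_or_lt_of_le (zero_le (a := r)) with hr | hr
    · rw [← hr]
      simp [Real.zero_rpow (by linarith : 1 + s ≠ 0)]
    · have hr' : (0 : ℝ) < r := hr
      rw [Real.rpow_add hr', Real.rpow_one, ← mul_sub, abs_mul, abs_of_pos hr']
      exact mul_le_mul_of_nonneg_left
        (abs_integral_powerEstimator_sub_le hs0 hs (by linarith) hr) hr'.le
  · refine (abs_powerEstimator_le hs0 hs hW z).trans ?_
    have he : √((z : ℝ) + 1) ≤ Real.exp z := by
      have h2 := Real.add_one_le_exp (z : ℝ)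
      have h3 : (0 : ℝ) ≤ z := Nat.cast_nonneg z
      rw [Real.sqrt_le_left (Real.exp_pos _).le]
      nlinarith
    rw [mul_assoc (besselConst s)⁻¹]
    gcongr

open MeasureTheory ProbabilityTheory in
theorem poissonProb_eq_measure_pi {S : ℕ} {lam : ℝ} {P : Fin S → ℝ} {r : Fin S → NNReal}
    (hr : ∀ i, (r i : ℝ) = lam * P i) (A : Set (Fin S → ℕ)) :
    poissonProb S lam P A = Measure.pi (fun i => poissonMeasure (r i)) A := by
  rw [← Measure.tsum_indicator_apply_singleton _ A A.to_countable.measurableSet, poissonProb]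
  refine tsum_congr fun z => ?_
  classical
  rw [Set.indicator_apply, Measure.pi_singleton, _root_.poissonPMF,
    ENNReal.ofReal_prod_of_nonneg fun i _ => by rw [← hr]; positivity]
  simp only [poissonMeasure_singleton, hr]

open MeasureTheory ProbabilityTheory in
/-- Chebyshev's inequality for a sum of functions of independent variables, with bias. -/
theorem measure_pi_le_abs_sum_sub_le {ι : Type*} [Fintype ι] {Ω : ι → Type*}
    [∀ i, MeasurableSpace (Ω i)] {μ : ∀ i, Measure (Ω i)} [∀ i, IsProbabilityMeasure (μ i)]
    {X : ∀ i, Ω i → ℝ} (hX : ∀ i, MemLp (X i) 2 (μ i)) {G a V : ℝ} (ha : 0 < a)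
    (hbias : |∑ i, ∫ ω, X i ω ∂μ i - G| ≤ a) (hV : ∑ i, Var[X i; μ i] ≤ V) :
    Measure.pi μ {ω | 2 * a ≤ |∑ i, X i (ω i) - G|} ≤ ENNReal.ofReal (V / a ^ 2) := by
  set T : (∀ i, Ω i) → ℝ := ∑ i, fun ω ↦ X i (ω i) with hT
  have hc : ∀ i, MemLp (fun ω : ∀ i, Ω i ↦ X i (ω i)) 2 (Measure.pi μ) := fun i =>
    (hX i).comp_measurePreserving (measurePreserving_eval μ i)
  have hmem : MemLp T 2 (Measure.pi μ) := memLp_finsetSum' _ fun i _ => hc i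
  have hmean : (Measure.pi μ)[T] = ∑ i, ∫ ω, X i ω ∂μ i := by
    simp only [hT, Finset.sum_apply]
    rw [integral_finsetSum _ fun i _ => (hc i).integrable one_le_two]
    refine Finset.sum_congr rfl fun i _ => ?_
    exact integral_comp_eval (hX i).aestronglyMeasurable
  calc Measure.pi μ {ω | 2 * a ≤ |∑ i, X i (ω i) - G|}
      ≤ Measure.pi μ {ω | a ≤ |T ω - (Measure.pi μ)[T]|} := by
        refine measure_mono fun ω hω => ?_
        have h1 : 2 * a ≤ |∑ i, X i (ω i) - G| := hω
        have h2 : T ω = ∑ i, X i (ω i) := by simp [hT]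
        have h3 := abs_sub_le (T ω) ((Measure.pi μ)[T]) G
        rw [← hmean] at hbias
        rw [← h2] at h1
        show a ≤ _
        linarith
    _ ≤ ENNReal.ofReal (Var[T; Measure.pi μ] / a ^ 2) := meas_ge_le_variance_div_sq hmem ha
    _ ≤ ENNReal.ofReal (V / a ^ 2) := by
        rw [hT, variance_sum_pi hX]
        gcongr

theorem abs_log_lt_of_abs_sub_one_lt {x θ : ℝ} (h : |x - 1| < 1 - Real.exp (-θ)) :
    |Real.log x| < θ := by
  have hx := abs_lt.1 h
  have h0 : Real.exp (-θ) < x := by linarith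
  have hx0 : 0 < x := (Real.exp_pos _).trans h0
  have hθ : x < Real.exp θ := by
    have h1 : Real.exp (-θ) * Real.exp θ = 1 := by rw [← Real.exp_add]; simp
    nlinarith [Real.exp_pos θ, Real.exp_pos (-θ), sq_nonneg (Real.exp θ - 1)]
  exact abs_lt.2 ⟨(Real.lt_log_iff_exp_lt hx0).2 h0, (Real.log_lt_iff_lt_exp hx0).2 hθ⟩

theorem rpow_mul_sum_le {S : ℕ} {r : Fin S → ℝ} (hr : ∀ i, 0 ≤ r i) {s : ℝ} (hs : 0 < s) :
    (∑ i, r i) ^ (1 + s) ≤ (S : ℝ) ^ s * ∑ i, r i ^ (1 + s) := by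
  have h := Real.rpow_sum_le_const_mul_sum_rpow_of_nonneg Finset.univ
    (by linarith : 1 ≤ 1 + s) (f := r) fun i _ => hr i
  simpa using h

theorem sum_sq_le_sum_mul_rpow {ι : Type*} [Fintype ι] {r : ι → ℝ} (hr : ∀ i, 0 ≤ r i) {α : ℝ}
    (hα : 0 < α) :
    ∑ i, r i ^ 2 ≤ (∑ i, r i) * (∑ i, r i ^ α) ^ α⁻¹ := by
  rw [Finset.sum_mul]
  refine Finset.sum_le_sum fun i _ => ?_
  rw [sq]
  refine mul_le_mul_of_nonneg_left ?_ (hr i)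
  calc r i = (r i ^ α) ^ α⁻¹ := (Real.rpow_rpow_inv (hr i) hα.ne').symm
    _ ≤ _ := by
      refine Real.rpow_le_rpow (Real.rpow_nonneg (hr i) _) ?_ (inv_pos.2 hα).le
      exact Finset.single_le_sum (f := fun j => r j ^ α)
        (fun j _ => Real.rpow_nonneg (hr j) _) (Finset.mem_univ i)

/-- In the regime `c * S ≤ N * L`, the power sum is at least of order `N * (c / L) ^ s`. -/
theorem mul_rpow_le_of_mul_le {S N L G c s : ℝ} (hS : 0 < S) (hN : 0 < N) (hL : 0 ≤ L)
    (hc : 0 ≤ c) (hs : 0 < s) (hcS : c * S ≤ N * L) (hG : N ^ (1 + s) ≤ S ^ s * G) :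
    N * c ^ s ≤ G * L ^ s := by
  have hSs : 0 < S ^ s := Real.rpow_pos_of_pos hS s
  refine le_of_mul_le_mul_left ?_ hSs
  calc S ^ s * (N * c ^ s) = N * (c * S) ^ s := by rw [Real.mul_rpow hc hS.le]; ring
    _ ≤ N * (N * L) ^ s := by gcongr
    _ = N ^ (1 + s) * L ^ s := by
      rw [Real.mul_rpow hN.le hL, Real.rpow_add hN, Real.rpow_one]
      ring
    _ ≤ S ^ s * G * L ^ s := by gcongr
    _ = _ := by ring

open MeasureTheory ProbabilityTheory in
/-- Concentration of the power sum estimator at scale `η * G`. -/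
theorem measure_pi_powerSumTerm_le {S : ℕ} (hS : 0 < S) {r : Fin S → NNReal} {s c N η ε β : ℝ}
    (hs0 : 0 < s) (hs : s < 1 / 2) (hc : 1 ≤ c) (hN : ∑ i, (r i : ℝ) = N) (hN0 : 0 < N)
    (hη : 0 < η) (hcS : c * S ≤ N * Real.log S) (hβ : β = (1 - (1 + s)⁻¹) / 16)
    (hL : 1 ≤ Real.log S) (hW : 1 ≤ β * Real.log S)
    (hbias : (besselConst s)⁻¹ * (β ^ (-s) / s) ≤ η / 2 * c ^ s)
    (hlarge : Real.log S ^ (1 + s) ≤ (S : ℝ) ^ (1 / 2 : ℝ))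
    (hvar : 6 * oscillationConst s ^ 2 * Real.log S ^ s ≤
      ε * (η / 2) ^ 2 * (S : ℝ) ^ (4 * β)) :
    Measure.pi (fun i => poissonMeasure (r i))
      {z | η * ∑ i, (r i : ℝ) ^ (1 + s) ≤
        |∑ i, powerSumTerm s (β * Real.log S) (z i) - ∑ i, (r i : ℝ) ^ (1 + s)|} ≤
      ENNReal.ofReal ε := by
  set L := Real.log S with hLdef
  set G := ∑ i, (r i : ℝ) ^ (1 + s) with hGdef
  set W := β * L with hWdef
  set B := oscillationConst s * Real.exp (2 * W) with hBdef
  have hS' : (0 : ℝ) < S := by exact_mod_cast hS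
  have hL0 : 0 < L := by linarith
  have hβ0 : 0 < β := pos_of_mul_pos_left (by linarith : 0 < β * L) hL0.le
  have hLs : 0 < L ^ s := Real.rpow_pos_of_pos hL0 s
  have hK := inv_pos.2 (besselConst_pos hs0 hs)
  have hB0 : 0 ≤ B := by
    have := oscillationConst_pos hs0 hs
    positivity
  have hr0 : ∀ i, (0 : ℝ) ≤ r i := fun i => (r i).2
  have hGlow : N * c ^ s ≤ G * L ^ s := by
    refine mul_rpow_le_of_mul_le hS' hN0 hL0.le (by linarith) hs0 hcS ?_
    rw [← hN]
    exact rpow_mul_sum_le hr0 hs0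
  have hcs : 1 ≤ c ^ s := Real.one_le_rpow hc hs0.le
  have hNG : N ≤ G * L ^ s := (le_mul_of_one_le_right hN0.le hcs).trans hGlow
  have hG0 : 0 < G := pos_of_mul_pos_left (hN0.trans_le hNG) hLs.le
  have hSG : (S : ℝ) ^ (1 / 2 : ℝ) ≤ G := by
    have hh : 0 < (S : ℝ) ^ (1 / 2 : ℝ) := Real.rpow_pos_of_pos hS' _
    refine le_of_mul_le_mul_right ?_ hh
    calc (S : ℝ) ^ (1 / 2 : ℝ) * (S : ℝ) ^ (1 / 2 : ℝ) = S := by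
          rw [← Real.rpow_add hS']
          norm_num
      _ ≤ N * L := (le_mul_of_one_le_left hS'.le hc).trans hcS
      _ ≤ G * L ^ s * L := by gcongr
      _ = G * L ^ (1 + s) := by rw [Real.rpow_add hL0, Real.rpow_one]; ring
      _ ≤ G * (S : ℝ) ^ (1 / 2 : ℝ) := by gcongr
  have hG1 : 1 ≤ G := by
    refine le_trans (Real.one_le_rpow ?_ (by norm_num)) hSG
    exact_mod_cast hS
  have hstep : ∀ z : ℕ, |powerSumTerm s W (z + 1) - powerSumTerm s W z| ≤ B * √(z + 1) :=
    abs_mul_powerEstimator_succ_sub_le hs0 hs hW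
  have hmem := fun i => memLp_two_poissonMeasure_of_abs_succ_sub_le hB0 hstep (r i)
  have hmean : |∑ i, ∫ z, powerSumTerm s W z ∂poissonMeasure (r i) - G| ≤ η / 2 * G := by
    rw [hGdef, ← Finset.sum_sub_distrib]
    refine (Finset.abs_sum_le_sum_abs _ _).trans ?_
    refine (Finset.sum_le_sum fun i _ => abs_integral_powerSumTerm_sub_le hs0 hs hW (r i)).trans ?_
    rw [← Finset.sum_mul, hN, ← hGdef]
    refine le_of_mul_le_mul_right ?_ hLs
    calc N * ((besselConst s)⁻¹ * (W ^ (-s) / s)) * L ^ s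
        = N * ((besselConst s)⁻¹ * (β ^ (-s) / s)) * (L ^ (-s) * L ^ s) := by
          rw [hWdef, Real.mul_rpow hβ0.le hL0.le]
          ring
      _ = N * ((besselConst s)⁻¹ * (β ^ (-s) / s)) := by
          rw [← Real.rpow_add hL0, neg_add_cancel, Real.rpow_zero, mul_one]
      _ ≤ N * (η / 2 * c ^ s) := by gcongr
      _ = η / 2 * (N * c ^ s) := by ring
      _ ≤ η / 2 * (G * L ^ s) := by gcongr
      _ = η / 2 * G * L ^ s := by ring
  have hsq := sum_sq_le_sum_mul_rpow hr0 (by linarith : 0 < 1 + s)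
  rw [hN, ← hGdef] at hsq
  have hGα : 1 ≤ G ^ (1 + s)⁻¹ := Real.one_le_rpow hG1 (by positivity)
  have hBS : B ^ 2 = oscillationConst s ^ 2 * (S : ℝ) ^ (4 * β) := by
    rw [hBdef, mul_pow, ← Real.exp_nat_mul, Real.rpow_def_of_pos hS']
    congr 2
    push_cast
    rw [hWdef]
    ring
  have hV : ∑ i, Var[powerSumTerm s W; poissonMeasure (r i)] ≤ ε * (η / 2 * G) ^ 2 := by
    calc ∑ i, Var[powerSumTerm s W; poissonMeasure (r i)]
        ≤ ∑ i, 3 * B ^ 2 * ((r i : ℝ) ^ 2 + r i) :=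
          Finset.sum_le_sum fun i _ => variance_poissonMeasure_le hB0 hstep (r i)
      _ = 3 * B ^ 2 * (∑ i, (r i : ℝ) ^ 2 + N) := by
          rw [← Finset.mul_sum, Finset.sum_add_distrib, hN]
      _ ≤ 3 * B ^ 2 * (N * G ^ (1 + s)⁻¹ + N * G ^ (1 + s)⁻¹) := by
          gcongr
          exact le_mul_of_one_le_right hN0.le hGα
      _ = 6 * B ^ 2 * G ^ (1 + s)⁻¹ * N := by ring
      _ ≤ 6 * B ^ 2 * G ^ (1 + s)⁻¹ * (G * L ^ s) := by gcongr
      _ = (6 * oscillationConst s ^ 2 * L ^ s) * ((S : ℝ) ^ (4 * β) * G ^ (1 + s)⁻¹ * G) := by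
          rw [hBS]
          ring
      _ ≤ (ε * (η / 2) ^ 2 * (S : ℝ) ^ (4 * β)) *
          ((S : ℝ) ^ (4 * β) * G ^ (1 + s)⁻¹ * G) := by gcongr
      _ = ε * (η / 2) ^ 2 * G * (((S : ℝ) ^ (1 / 2 : ℝ)) ^ (16 * β) * G ^ (1 + s)⁻¹) := by
          rw [← Real.rpow_mul hS'.le, show 1 / 2 * (16 * β) = 4 * β + 4 * β by ring,
            Real.rpow_add hS']
          ring
      _ ≤ ε * (η / 2) ^ 2 * G * (G ^ (16 * β) * G ^ (1 + s)⁻¹) := by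
          have hε : 0 ≤ ε := by
            have h1 : 0 ≤ ε * ((η / 2) ^ 2 * (S : ℝ) ^ (4 * β)) := by
              rw [← mul_assoc]
              exact le_trans (by positivity) hvar
            exact nonneg_of_mul_nonneg_left h1 (by positivity)
          gcongr
      _ = ε * (η / 2 * G) ^ 2 := by
          rw [← Real.rpow_add hG0, hβ,
            show 16 * ((1 - (1 + s)⁻¹) / 16) + (1 + s)⁻¹ = 1 by ring, Real.rpow_one]
          ring
  have hfin := measure_pi_le_abs_sum_sub_le hmem (by positivity : 0 < η / 2 * G) hmean hV
  rwa [show 2 * (η / 2 * G) = η * G by ring,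
    mul_div_cancel_right₀ _ (by positivity : (η / 2 * G) ^ 2 ≠ 0)] at hfin

open Filter in
theorem eventually_mul_log_rpow_le (C a : ℝ) {D b : ℝ} (hD : 0 < D) (hb : 0 < b) :
    ∀ᶠ S : ℕ in atTop, C * Real.log S ^ a ≤ D * (S : ℝ) ^ b := by
  have h := ((isLittleO_log_rpow_rpow_atTop a hb).const_mul_left C).def hD
  filter_upwards [tendsto_natCast_atTop_atTop.eventually h] with S hS
  refine (le_abs_self _).trans (hS.trans_eq ?_)
  rw [Real.norm_of_nonneg (Real.rpow_nonneg (Nat.cast_nonneg S) b)]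

open Filter in
theorem eventually_le_mul_log (C : ℝ) {D : ℝ} (hD : 0 < D) :
    ∀ᶠ S : ℕ in atTop, C ≤ D * Real.log S :=
  ((Real.tendsto_log_atTop.comp tendsto_natCast_atTop_atTop).const_mul_atTop
    hD).eventually_ge_atTop C

theorem renyi_estimation_sublinear (α : ℝ) (hα1 : 1 < α) (hα2 : α < 3 / 2)
    (δ : ℝ) (hδ : 0 < δ) (ε : ℝ) (hε0 : 0 < ε) (hε1 : ε < 1) :
    ∃ c : ℝ, 0 < c ∧ ∃ S₀ : ℕ, 2 ≤ S₀ ∧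
      ∃ Hhat : ∀ n S : ℕ, (Fin S → ℕ) → ℝ,
        ∀ S : ℕ, S₀ ≤ S → ∀ n : ℕ, c * (S : ℝ) ≤ (n : ℝ) * Real.log S →
          ∀ P ∈ simplex S,
            poissonProb S (n : ℝ) P {z | δ ≤ |Hhat n S z - renyi S α P|}
              ≤ ENNReal.ofReal ε := by
  obtain ⟨s, rfl⟩ : ∃ s, α = 1 + s := ⟨α - 1, by ring⟩
  have hs0 : 0 < s := by linarith
  have hs : s < 1 / 2 := by linarith
  obtain ⟨β, hβ⟩ : ∃ β, β = (1 - (1 + s)⁻¹) / 16 := ⟨_, rfl⟩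
  have hβ0 : 0 < β := by
    have : (1 + s)⁻¹ < 1 := inv_lt_one_of_one_lt₀ hα1
    rw [hβ]
    linarith
  obtain ⟨η, hηdef⟩ : ∃ η, η = 1 - Real.exp (-(δ * s)) := ⟨_, rfl⟩
  have hη : 0 < η := by
    have : Real.exp (-(δ * s)) < 1 := Real.exp_lt_one_iff.2 (by nlinarith)
    linarith
  have hK := inv_pos.2 (besselConst_pos hs0 hs)
  obtain ⟨c, hc, hbias⟩ : ∃ c : ℝ, 1 ≤ c ∧
      (besselConst s)⁻¹ * (β ^ (-s) / s) ≤ η / 2 * c ^ s := by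
    have h := ((tendsto_rpow_atTop hs0).const_mul_atTop (half_pos hη)).eventually_ge_atTop
      ((besselConst s)⁻¹ * (β ^ (-s) / s))
    exact ((Filter.eventually_ge_atTop 1).and h).exists
  have hev := (Filter.eventually_ge_atTop 2).and
    ((eventually_le_mul_log 1 one_pos).and ((eventually_le_mul_log 1 hβ0).and
    ((eventually_mul_log_rpow_le 1 (1 + s) one_pos (by norm_num : (0 : ℝ) < 1 / 2)).and
    (eventually_mul_log_rpow_le (6 * oscillationConst s ^ 2) s
      (by positivity : 0 < ε * (η / 2) ^ 2) (by positivity : 0 < 4 * β)))))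
  obtain ⟨S₀, hS₀⟩ := Filter.eventually_atTop.1 hev
  refine ⟨c, by linarith, S₀, (hS₀ S₀ le_rfl).1, fun n S z =>
    1 / (1 - (1 + s)) * Real.log ((∑ i, powerSumTerm s (β * Real.log S) (z i)) / (n : ℝ) ^ (1 + s)),
    fun S hS n hcS P hP => ?_⟩
  obtain ⟨hS2, hL, hW, hlarge, hvar⟩ := hS₀ S hS
  rw [one_mul] at hL
  rw [one_mul, one_mul] at hlarge
  have hS' : (0 : ℝ) < S := by positivity
  have hn : (0 : ℝ) < n := by
    have h1 : 0 < c * S := by positivity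
    exact pos_of_mul_pos_left (h1.trans_le hcS) (by linarith)
  set r : Fin S → NNReal := fun i => ⟨n * P i, mul_nonneg hn.le (hP.1 i)⟩ with hrdef
  have hr : ∀ i, (r i : ℝ) = n * P i := fun i => rfl
  have hsum : ∑ i, (r i : ℝ) = n := by
    simp only [hr]
    rw [← Finset.mul_sum, hP.2, mul_one]
  have hmain := measure_pi_powerSumTerm_le (by omega) hs0 hs hc hsum hn hη hcS hβ hL hW hbias
    hlarge hvar
  rw [poissonProb_eq_measure_pi hr]
  refine (MeasureTheory.measure_mono fun z hz => ?_).trans hmain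
  by_contra hlt
  set G := ∑ i, (r i : ℝ) ^ (1 + s) with hGdef
  have hnα : 0 < (n : ℝ) ^ (1 + s) := Real.rpow_pos_of_pos hn _
  have hF : Falpha S (1 + s) P = G / (n : ℝ) ^ (1 + s) := by
    rw [Falpha, hGdef, Finset.sum_div]
    refine Finset.sum_congr rfl fun i _ => ?_
    rw [hr, Real.mul_rpow hn.le (hP.1 i)]
    field_simp
  have hG0 : 0 < G := by
    have h1 := rpow_mul_sum_le (fun i => (r i).2) hs0 (S := S)
    refine pos_of_mul_pos_left (b := (S : ℝ) ^ s) ?_ (by positivity)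
    rw [mul_comm]
    refine lt_of_lt_of_le hnα (le_trans (le_of_eq ?_) h1)
    rw [← hsum]
    rfl
  have hlt' : |∑ i, powerSumTerm s (β * Real.log S) (z i) - G| < η * G := not_le.1 hlt
  set T := ∑ i, powerSumTerm s (β * Real.log S) (z i) with hT
  have hratio : |T / G - 1| < 1 - Real.exp (-(δ * s)) := by
    rw [← hηdef, div_sub_one hG0.ne', abs_div, abs_of_pos hG0, div_lt_iff₀ hG0]
    exact hlt'
  have hT0 : 0 < T := by
    have h1 := (abs_lt.1 hratio).1
    have h2 : 0 < T / G := by linarith [Real.exp_pos (-(δ * s))]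
    exact (div_pos_iff_of_pos_right hG0).1 h2
  have hz' : δ ≤ |1 / (1 - (1 + s)) * Real.log (T / (n : ℝ) ^ (1 + s)) -
      renyi S (1 + s) P| := hz
  rw [renyi, hF, ← mul_sub, ← Real.log_div (by positivity) (by positivity),
    div_div_div_cancel_right₀ hnα.ne', abs_mul,
    show 1 / (1 - (1 + s)) = -(1 / s) by rw [← one_div_neg_eq_neg_one_div]; ring_nf,
    abs_neg, abs_of_pos (by positivity), one_div, inv_mul_eq_div, le_div_iff₀ hs0] at hz'
  exact absurd (abs_log_lt_of_abs_sub_one_lt hratio) (not_lt.2 hz')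
end

section
/- For every β ∈ (0, 1/2) there exist constants D > 0 and c > 0 and an integer L₀ such that for every integer L ≥ L₀, E_L[x^β]_{[(DL)^{−2}, 1]} ≥ c·L^{−2β}. Equivalently, liminf_{L→∞} L^{2β}·E_L[x^β]_{[(DL)^{−2},1]} > 0. -/
open scoped BigOperators

/-- Best uniform polynomial approximation error of `f` on `[a, b]` by real polynomials
of degree at most `L`. -/
noncomputable def approxErr (f : ℝ → ℝ) (L : ℕ) (a b : ℝ) : ℝ :=
  ⨅ p : {p : Polynomial ℝ // p.natDegree ≤ L},
    ⨆ x : Set.Icc a b, |f (x : ℝ) - (p : Polynomial ℝ).eval (x : ℝ)|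

open Polynomial

/-- Markov's inequality at the left endpoint of an interval. -/
lemma abs_eval_derivative_left_le {P : ℝ[X]} {n : ℕ} (hP : P.natDegree ≤ n) {a b M : ℝ}
    (hab : a < b) (hM : 0 < M) (hbnd : ∀ x ∈ Set.Icc a b, |P.eval x| ≤ M) :
    |(derivative P).eval a| ≤ 2 * (n : ℝ) ^ 2 * M / (b - a) := by
  have hba : 0 < b - a := sub_pos.mpr hab
  have endpoint (s : ℝ) (hs : |s| = 1) :
      s * (derivative P).eval a ≤ 2 * (n : ℝ) ^ 2 * M / (b - a) := by
    set ℓ : ℝ[X] := C ((a + b) / 2) - C ((b - a) / 2) * X with hℓ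
    have hℓdeg : ℓ.natDegree ≤ 1 := by rw [hℓ]; compute_degree
    set Q : ℝ[X] := C (-s / M) * P.comp ℓ with hQ
    have hQdeg : Q.degree ≤ n := by
      refine natDegree_le_iff_degree_le.mp ((natDegree_C_mul_le _ _).trans ?_)
      rw [natDegree_comp]
      calc P.natDegree * ℓ.natDegree ≤ n * 1 := Nat.mul_le_mul hP hℓdeg
        _ = n := mul_one n
    have hQbnd : ∀ x ∈ Set.Icc (-1 : ℝ) 1, |Q.eval x| ≤ 1 := by
      rintro x ⟨hx₁, hx₂⟩
      have hmem : ℓ.eval x ∈ Set.Icc a b := by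
        simp only [hℓ, eval_sub, eval_C, eval_mul, eval_X]
        constructor <;> nlinarith
      have := hbnd _ hmem
      rw [hQ, eval_mul, eval_C, eval_comp, abs_mul, abs_div, abs_neg, hs, abs_of_pos hM]
      rw [one_div, inv_mul_le_iff₀ hM, mul_one]
      exact this
    have key := Polynomial.Chebyshev.eval_iterate_derivative_le_of_forall_abs_le_one
      (k := 1) (le_refl (1 : ℝ)) hQdeg hQbnd
    simp only [Function.iterate_one, Polynomial.Chebyshev.T_derivative_eq_U, eval_mul,
      hQ, derivative_mul, derivative_comp, derivative_C, hℓ, derivative_sub, derivative_X,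
      eval_comp, eval_sub, eval_neg, eval_C, eval_X, Polynomial.Chebyshev.U_eval_one,
      eval_intCast, zero_mul, zero_add, mul_one, zero_sub] at key
    push_cast at key
    rw [show (a + b) / 2 - (b - a) / 2 = a by ring] at key
    rw [le_div_iff₀ hba]
    have h2 := mul_le_mul_of_nonneg_left key (by positivity : 0 ≤ 2 * M)
    have h3 : 2 * M * (-s / M * (-((b - a) / 2) * eval a (derivative P)))
        = s * eval a (derivative P) * (b - a) := by field_simp
    rw [h3] at h2
    linarith
  refine abs_le.mpr ⟨?_, ?_⟩
  · linarith [endpoint (-1) (by simp)]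
  · linarith [endpoint 1 (by simp)]

/-- A polynomial bounded on `[a, 1]` is Lipschitz on `[a, 1/2]` with constant quadratic in the
degree. -/
lemma abs_eval_sub_eval_le {P : ℝ[X]} {n : ℕ} (hP : P.natDegree ≤ n) {a M x y : ℝ}
    (hM : 0 < M) (hbnd : ∀ z ∈ Set.Icc a 1, |P.eval z| ≤ M)
    (hax : a ≤ x) (hxy : x ≤ y) (hy : y ≤ 1 / 2) :
    |P.eval y - P.eval x| ≤ 4 * (n : ℝ) ^ 2 * M * (y - x) := by
  have h := (convex_Icc x y).norm_image_sub_le_of_norm_hasDerivWithin_le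
    (f := fun z => P.eval z) (f' := fun z => (derivative P).eval z)
    (C := 4 * (n : ℝ) ^ 2 * M) (fun z _ => (P.hasDerivAt z).hasDerivWithinAt) ?_
    (Set.left_mem_Icc.mpr hxy) (Set.right_mem_Icc.mpr hxy)
  · simpa [Real.norm_eq_abs, abs_of_nonneg (sub_nonneg.mpr hxy)] using h
  · rintro z ⟨hz₁, hz₂⟩
    refine (abs_eval_derivative_left_le hP (by linarith : z < 1) hM
      fun w hw => hbnd w ⟨by linarith [hw.1], hw.2⟩).trans ?_
    rw [div_le_iff₀ (by linarith)]
    have : 0 ≤ (n : ℝ) ^ 2 * M := by positivity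
    nlinarith

lemma abs_sin_nat_mul_le_mul_abs_sin (n : ℕ) (θ : ℝ) :
    |Real.sin (n * θ)| ≤ n * |Real.sin θ| := by
  induction n with
  | zero => simp
  | succ n ih =>
    have h₁ : |Real.sin (n * θ) * Real.cos θ| ≤ n * |Real.sin θ| := by
      rw [abs_mul]
      exact (mul_le_of_le_one_right (abs_nonneg _) (Real.abs_cos_le_one θ)).trans ih
    have h₂ : |Real.cos (n * θ) * Real.sin θ| ≤ |Real.sin θ| := by
      rw [abs_mul]
      exact mul_le_of_le_one_left (abs_nonneg _) (Real.abs_cos_le_one _)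
    push_cast
    rw [add_mul, one_mul, Real.sin_add]
    linarith [abs_add_le (Real.sin (n * θ) * Real.cos θ) (Real.cos (n * θ) * Real.sin θ)]

/-- A Fejér-type polynomial kernel concentrated near the left endpoint of `[0, 1]`. -/
lemma exists_localizing_polynomial {n : ℕ} (hn : 1 ≤ n) :
    ∃ q : ℝ[X], q.natDegree ≤ n ∧ q.eval 0 = 1 ∧
      (∀ x ∈ Set.Icc (0 : ℝ) 1, |q.eval x| ≤ 1) ∧
      ∀ x ∈ Set.Icc (0 : ℝ) 1, |q.eval x| * x ≤ ((n : ℝ) ^ 2)⁻¹ := by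
  have hn0 : (0 : ℝ) < n := by exact_mod_cast hn
  set R : ℝ[X] := 1 - (Chebyshev.T ℝ n).comp (1 - 2 * X) with hR
  have hR0 : R.coeff 0 = 0 := by simp [hR, coeff_zero_eq_eval_zero]
  have hRX : X * R.divX = R := by simpa [hR0] using X_mul_divX_add R
  have hRdeg : R.natDegree ≤ n := by
    have hlin : (1 - 2 * X : ℝ[X]).natDegree ≤ 1 := by compute_degree
    refine (natDegree_sub_le _ _).trans (max_le (by simp) ?_)
    rw [natDegree_comp, Chebyshev.natDegree_T]
    simpa using Nat.mul_le_mul_left n hlin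
  have hRd : R.divX.eval 0 = 2 * (n : ℝ) ^ 2 := by
    have h := congrArg (fun p => (derivative p).eval 0) hRX
    simp [hR, derivative_comp, Chebyshev.T_derivative_eq_U] at h
    simp only [← hR] at h
    linarith
  set q : ℝ[X] := C (2 * (n : ℝ) ^ 2)⁻¹ * R.divX with hq
  have hq0 : q.eval 0 = 1 := by
    rw [hq, eval_mul, eval_C, hRd]
    exact inv_mul_cancel₀ (by positivity)
  have hqx (x : ℝ) : x * q.eval x = (2 * (n : ℝ) ^ 2)⁻¹ * R.eval x := by
    conv_rhs => rw [← hRX]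
    rw [hq, eval_mul, eval_mul, eval_C, eval_X]
    ring
  have hqsin (x : ℝ) (hx : x ∈ Set.Icc (0 : ℝ) 1) :
      ∃ θ : ℝ, x = Real.sin θ ^ 2 ∧ x * q.eval x = Real.sin (n * θ) ^ 2 / (n : ℝ) ^ 2 := by
    set θ := Real.arcsin (√x) with hθ
    have hxθ : x = Real.sin θ ^ 2 := by
      rw [hθ, Real.sin_arcsin (by linarith [Real.sqrt_nonneg x]) (Real.sqrt_le_one.mpr hx.2),
        Real.sq_sqrt hx.1]
    have hcos : 1 - 2 * x = Real.cos (2 * θ) := by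
      rw [hxθ, Real.cos_two_mul, Real.cos_sq']; ring
    have hev : R.eval x = 1 - (Chebyshev.T ℝ n).eval (1 - 2 * x) := by simp [hR]
    have hRθ : R.eval x = 2 * Real.sin (n * θ) ^ 2 := by
      rw [hev, hcos, Chebyshev.T_real_cos, Int.cast_natCast,
        show (n : ℝ) * (2 * θ) = 2 * (n * θ) by ring, Real.cos_two_mul, Real.cos_sq']
      ring
    refine ⟨θ, hxθ, ?_⟩
    rw [hqx, hRθ]
    field_simp
  refine ⟨q, (natDegree_C_mul_le _ _).trans ?_, hq0, ?_, ?_⟩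
  · rw [natDegree_divX_eq_natDegree_tsub_one]; omega
  · intro x hx
    rcases hx.1.eq_or_lt with rfl | hx0
    · rw [hq0, abs_one]
    obtain ⟨θ, hxθ, hxq⟩ := hqsin x hx
    have hs : Real.sin (n * θ) ^ 2 ≤ (n : ℝ) ^ 2 * x := by
      have h := pow_le_pow_left₀ (abs_nonneg _) (abs_sin_nat_mul_le_mul_abs_sin n θ) 2
      rwa [mul_pow, sq_abs, sq_abs, ← hxθ] at h
    have hle : x * q.eval x ≤ x * 1 := by
      rw [hxq, div_le_iff₀ (by positivity)]; linarith
    have hnn : x * 0 ≤ x * q.eval x := by rw [hxq, mul_zero]; positivity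
    rw [abs_of_nonneg (le_of_mul_le_mul_left hnn hx0)]
    exact le_of_mul_le_mul_left hle hx0
  · intro x hx
    obtain ⟨θ, -, hxq⟩ := hqsin x hx
    nth_rewrite 2 [← abs_of_nonneg hx.1]
    rw [← abs_mul, mul_comm, hxq, abs_of_nonneg (by positivity), ← one_div]
    gcongr
    exact Real.sin_sq_le_one _

/-- A factor bounded by `min 1 (N ^ 2 * x)⁻¹` reduces `x ^ β` to size `N ^ (-2β)`. -/
lemma mul_rpow_le_of_localized {β : ℝ} (hβ0 : 0 < β) (hβ1 : β < 1) {N x Q : ℝ} (hN : 0 < N)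
    (hx : 0 < x) (hQ : Q ≤ 1) (hQx : Q * x ≤ (N ^ 2)⁻¹) :
    Q * x ^ β ≤ N ^ (-(2 * β)) := by
  have hpow (s : ℝ) : ((N ^ 2)⁻¹ : ℝ) ^ s = N ^ (-(2 * s)) := by
    rw [← Real.rpow_natCast, ← Real.rpow_neg hN.le, ← Real.rpow_mul hN.le]
    congr 1; push_cast; ring
  rw [← hpow]
  have hy : 0 < (N ^ 2)⁻¹ := by positivity
  rcases le_total x (N ^ 2)⁻¹ with h | h
  · calc Q * x ^ β ≤ 1 * x ^ β := by gcongr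
      _ ≤ ((N ^ 2)⁻¹) ^ β := by rw [one_mul]; gcongr
  · calc Q * x ^ β = (Q * x) * x ^ (β - 1) := by
          rw [Real.rpow_sub_one hx.ne']; field_simp
      _ ≤ (N ^ 2)⁻¹ * x ^ (β - 1) := by gcongr
      _ ≤ (N ^ 2)⁻¹ * ((N ^ 2)⁻¹) ^ (β - 1) :=
          mul_le_mul_of_nonneg_left (Real.rpow_le_rpow_of_nonpos hy h (by linarith)) hy.le
      _ = ((N ^ 2)⁻¹) ^ β := by
          rw [Real.rpow_sub_one hy.ne']; field_simp

/-- The gap estimate behind the lower bound: approximation to within `ε ≤ L ^ (-2β)` on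
`[(D L)⁻², 1]` forces `ε` to dominate the increment of `x ^ β` near the left endpoint, up to errors
of relative size `D⁻²`. -/
lemma gap_le_two_mul_error {β : ℝ} (hβ0 : 0 < β) (hβ1 : β < 1) {L : ℕ} (hL : 1 ≤ L) {D : ℝ}
    (hD : 2 ≤ D) {p : ℝ[X]} (hp : p.natDegree ≤ L) {ε : ℝ} (hε : ε ≤ (L : ℝ) ^ (-(2 * β)))
    (happ : ∀ x ∈ Set.Icc (((D * (L : ℝ)) ^ 2)⁻¹) 1, |x ^ β - p.eval x| ≤ ε) :
    (L : ℝ) ^ (-(2 * β)) *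
      (D ^ (-(2 * β)) * ((1 - 8 * (D ^ 2)⁻¹) * 2 ^ β - 1) - 32 * (D ^ 2)⁻¹) ≤ 2 * ε := by
  obtain ⟨q, hqdeg, hq0, hq1, hqx⟩ := exists_localizing_polynomial hL
  have hL1 : (1 : ℝ) ≤ L := by exact_mod_cast hL
  have hL0 : (0 : ℝ) < L := by linarith
  have hD0 : 0 < D := by linarith
  set a : ℝ := ((D * (L : ℝ)) ^ 2)⁻¹ with ha
  set t : ℝ := (L : ℝ) ^ (-(2 * β)) with ht
  set u : ℝ := D ^ (-(2 * β)) with hu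
  have ht0 : 0 < t := Real.rpow_pos_of_pos hL0 _
  have ha0 : 0 < a := by positivity
  have haL : (L : ℝ) ^ 2 * a = (D ^ 2)⁻¹ := by rw [ha]; field_simp
  have ha4 : 2 * a ≤ 1 / 2 := by
    have h4 : (4 : ℝ) ≤ (D * L) ^ 2 := by
      have : 2 ≤ D * L := by nlinarith
      nlinarith
    have := inv_anti₀ (by norm_num) h4
    rw [ha]; linarith
  have haβ : a ^ β = u * t := by
    rw [ha, hu, ht, ← Real.mul_rpow hD0.le hL0.le, ← Real.rpow_natCast,
      ← Real.rpow_neg (by positivity), ← Real.rpow_mul (by positivity)]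
    congr 1; push_cast; ring
  have h2aβ : (2 * a) ^ β = 2 ^ β * (u * t) := by
    rw [Real.mul_rpow (by norm_num) ha0.le, haβ]
  have herr : ∀ x ∈ Set.Icc a 1, |q.eval x * x ^ β - (q * p).eval x| ≤ ε := by
    intro x hx
    rw [eval_mul, ← mul_sub, abs_mul]
    exact (mul_le_of_le_one_left (abs_nonneg _) (hq1 x ⟨by linarith [hx.1], hx.2⟩)).trans (happ x hx)
  have hbnd : ∀ x ∈ Set.Icc a 1, |(q * p).eval x| ≤ 2 * t := by
    intro x hx
    have hx0 : 0 < x := by linarith [hx.1]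
    have h₁ : |q.eval x * x ^ β| ≤ t := by
      rw [abs_mul, abs_of_nonneg (Real.rpow_nonneg hx0.le β)]
      exact mul_rpow_le_of_localized hβ0 hβ1 hL0 hx0 (hq1 x ⟨hx0.le, hx.2⟩) (hqx x ⟨hx0.le, hx.2⟩)
    have h₂ := abs_sub_abs_le_abs_sub ((q * p).eval x) (q.eval x * x ^ β)
    rw [abs_sub_comm] at h₂
    linarith [herr x hx]
  have hdeg : (q * p).natDegree ≤ 2 * L := natDegree_mul_le.trans (by omega)
  have hlip := abs_eval_sub_eval_le hdeg (by positivity) hbnd le_rfl (by linarith : a ≤ 2 * a) ha4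
  have hqlip := abs_eval_sub_eval_le hqdeg one_pos hq1 le_rfl (by linarith : 0 ≤ 2 * a) ha4
  rw [hq0] at hqlip
  have hlip' : (q * p).eval (2 * a) - (q * p).eval a ≤ 32 * (D ^ 2)⁻¹ * t := by
    refine (le_abs_self _).trans (hlip.trans_eq ?_)
    rw [← haL]; push_cast; ring
  have hq2a : 1 - 8 * (D ^ 2)⁻¹ ≤ q.eval (2 * a) := by
    have := (abs_le.mp hqlip).1
    rw [← haL]; linarith
  have hqa : q.eval a ≤ 1 := (abs_le.mp (hq1 a ⟨ha0.le, by linarith⟩)).2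
  have e₁ := (abs_le.mp (herr a ⟨le_rfl, by linarith⟩)).1
  have e₂ := (abs_le.mp (herr (2 * a) ⟨by linarith, by linarith⟩)).2
  rw [haβ] at e₁
  rw [h2aβ] at e₂
  have hut : 0 < u * t := haβ ▸ Real.rpow_pos_of_pos ha0 β
  have m₁ := mul_le_mul_of_nonneg_right hqa hut.le
  have m₂ := mul_le_mul_of_nonneg_right hq2a
    (mul_pos (Real.rpow_pos_of_pos (by norm_num : (0 : ℝ) < 2) β) hut).le
  linarith

theorem approxErr_xbeta_lower_bound (β : ℝ) (hβ0 : 0 < β) (hβ1 : β < 1 / 2) :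
    ∃ D c : ℝ, 0 < D ∧ 0 < c ∧ ∃ L₀ : ℕ,
      ∀ L : ℕ, L₀ ≤ L →
        c * (L : ℝ) ^ (-(2 * β))
          ≤ approxErr (fun x => x ^ β) L (((D * (L : ℝ)) ^ 2)⁻¹) 1 := by
  set δ : ℝ := 2 ^ β - 1 with hδ
  have hδ0 : 0 < δ := sub_pos.mpr (Real.one_lt_rpow (by norm_num) hβ0)
  have hδ1 : δ ≤ 1 := by
    have : (2 : ℝ) ^ β ≤ 2 ^ (1 : ℝ) := Real.rpow_le_rpow_of_exponent_le (by norm_num) (by linarith)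
    rw [Real.rpow_one] at this
    linarith
  set D : ℝ := 96 / δ with hD
  have hD96 : 96 ≤ D := by rw [hD, le_div_iff₀ hδ0]; linarith
  have hD0 : 0 < D := by linarith
  have hDδ : D⁻¹ = δ / 96 := by rw [hD, inv_div]
  set u : ℝ := D ^ (-(2 * β)) with hu
  have hu0 : 0 < u := Real.rpow_pos_of_pos hD0 _
  have hu1 : u ≤ 1 := Real.rpow_le_one_of_one_le_of_nonpos (by linarith) (by linarith)
  have huD : D⁻¹ ≤ u := by
    rw [← Real.rpow_neg_one]
    exact Real.rpow_le_rpow_of_exponent_le (by linarith) (by linarith)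
  refine ⟨D, u * δ / 4, hD0, by positivity, 1, fun L hL => ?_⟩
  have hL0 : (0 : ℝ) < L := by exact_mod_cast hL
  have ht0 : 0 < (L : ℝ) ^ (-(2 * β)) := Real.rpow_pos_of_pos hL0 _
  have : Nonempty {p : ℝ[X] // p.natDegree ≤ L} := ⟨⟨0, by simp⟩⟩
  refine le_ciInf fun ⟨p, hp⟩ => ?_
  set ε : ℝ := ⨆ x : Set.Icc (((D * (L : ℝ)) ^ 2)⁻¹) 1, |(x : ℝ) ^ β - p.eval (x : ℝ)| with hε
  have hbdd : BddAbove (Set.range fun x : Set.Icc (((D * (L : ℝ)) ^ 2)⁻¹) (1 : ℝ) =>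
      |(x : ℝ) ^ β - p.eval (x : ℝ)|) := by
    refine (isCompact_range (Continuous.abs (Continuous.sub ?_ ?_))).bddAbove
    · exact continuous_subtype_val.rpow_const fun _ => Or.inr hβ0.le
    · exact p.continuous.comp continuous_subtype_val
  have happ : ∀ x ∈ Set.Icc (((D * (L : ℝ)) ^ 2)⁻¹) 1, |x ^ β - p.eval x| ≤ ε :=
    fun x hx => le_ciSup hbdd ⟨x, hx⟩
  change u * δ / 4 * (L : ℝ) ^ (-(2 * β)) ≤ ε
  rcases le_total ε ((L : ℝ) ^ (-(2 * β))) with hεt | hεt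
  · have hgap := gap_le_two_mul_error hβ0 (by linarith) hL (by linarith) hp hεt happ
    have hbracket : u * δ / 2 ≤
        u * ((1 - 8 * (D ^ 2)⁻¹) * 2 ^ β - 1) - 32 * (D ^ 2)⁻¹ := by
      have h2β : (2 : ℝ) ^ β = 1 + δ := by rw [hδ]; ring
      rw [h2β, ← inv_pow, hDδ]
      rw [hDδ] at huD
      have h₁ : (δ / 96) ^ 2 ≤ u * (δ / 96) := by
        rw [sq]; exact mul_le_mul_of_nonneg_right huD (by positivity)
      have h₂ : (δ / 96) ^ 2 * (1 + δ) ≤ δ / 48 := by nlinarith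
      have h₃ := mul_le_mul_of_nonneg_left h₂ hu0.le
      have h₄ : 0 ≤ u * δ := by positivity
      linarith
    have := mul_le_mul_of_nonneg_left hbracket ht0.le
    linarith
  · refine (mul_le_of_le_one_left ht0.le ?_).trans hεt
    have : u * δ ≤ 1 := mul_le_one₀ hu1 hδ0.le hδ1
    linarith
end

section
/- For every integer n ≥ 1 the best uniform polynomial approximation error of x^α on [0, 1] by polynomials of degree at most n satisfies: (i) if 0 < α < 1 then E_n[x^α]_{[0,1]} ≤ (π/(2n))^{2α}; (ii) if 1 < α < 3/2 then E_n[x^α]_{[0,1]} ≤ (3/2)·(π/n)^{2α}. -/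
open scoped BigOperators

open Polynomial MeasureTheory

/-- Integrating a family of polynomials of degree at most `n` pointwise gives a polynomial of
degree at most `n`. -/
theorem exists_polynomial_eval_eq_integral {Ω : Type*} [MeasurableSpace Ω] {μ : Measure Ω}
    {n : ℕ} {S : Set ℝ} (hS : S.Infinite) {g : Ω → ℝ → ℝ}
    (hpoly : ∀ᵐ t ∂μ, ∃ q : ℝ[X], q.natDegree ≤ n ∧ ∀ x ∈ S, g t x = q.eval x)
    (hint : ∀ x ∈ S, Integrable (fun t => g t x) μ) :
    ∃ p : ℝ[X], p.natDegree ≤ n ∧ ∀ x ∈ S, ∫ t, g t x ∂μ = p.eval x := by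
  obtain ⟨N, hNS, hN⟩ := hS.exists_subset_card_eq (n + 1)
  have hinj : Set.InjOn (id : ℝ → ℝ) N := Function.injective_id.injOn
  refine ⟨Lagrange.interpolate N id fun y => ∫ t, g t y ∂μ, ?_, fun x hx => ?_⟩
  · have hlt := Lagrange.degree_interpolate_lt (r := fun y => ∫ t, g t y ∂μ) hinj
    rw [hN] at hlt
    exact natDegree_le_iff_degree_le.2 (Order.le_of_lt_succ (by exact_mod_cast hlt))
  · have hsum : ∀ᵐ t ∂μ, g t x = ∑ y ∈ N, g t y * (Lagrange.basis N id y).eval x := by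
      filter_upwards [hpoly] with t ⟨q, hq, hgq⟩
      have hlt : q.degree < N.card := by
        rw [hN]
        exact (degree_le_of_natDegree_le hq).trans_lt (by exact_mod_cast Nat.lt_succ_self n)
      have heq := Lagrange.eq_interpolate hinj hlt
      rw [hgq x hx, heq, Lagrange.interpolate_apply, eval_finsetSum]
      refine Finset.sum_congr rfl fun y hy => ?_
      rw [eval_mul, eval_C, hgq y (hNS hy), id]
    rw [integral_congr_ae hsum, integral_finsetSum _ fun y hy =>
      (hint y (hNS hy)).mul_const _, Lagrange.interpolate_apply, eval_finsetSum]
    refine Finset.sum_congr rfl fun y _ => ?_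
    rw [integral_mul_const, eval_mul, eval_C]

/-- The second order Taylor polynomial of `T_n` at `1` bounds `T_n` from below on `[1, ∞)`. -/
theorem quadratic_le_eval_chebyshev_T (n : ℕ) {s : ℝ} (hs : 0 ≤ s) :
    1 + 2 * (n : ℝ) ^ 2 * s + 2 / 3 * (n : ℝ) ^ 2 * ((n : ℝ) ^ 2 - 1) * s ^ 2 ≤
      (Chebyshev.T ℝ n).eval (1 + 2 * s) := by
  have key : 1 + 2 * (n : ℝ) ^ 2 * s + 2 / 3 * (n : ℝ) ^ 2 * ((n : ℝ) ^ 2 - 1) * s ^ 2 ≤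
        (Chebyshev.T ℝ n).eval (1 + 2 * s) ∧
      2 * (2 * n + 1) * s + 4 / 3 * n * (n + 1) * (2 * n + 1) * s ^ 2 ≤
        (Chebyshev.T ℝ (n + 1)).eval (1 + 2 * s) - (Chebyshev.T ℝ n).eval (1 + 2 * s) := by
    induction n with
    | zero => constructor <;> simp
    | succ m ih =>
      obtain ⟨ihT, ihD⟩ := ih
      have hT : (1 : ℝ) + 2 * ((m : ℝ) + 1) ^ 2 * s +
          2 / 3 * ((m : ℝ) + 1) ^ 2 * (((m : ℝ) + 1) ^ 2 - 1) * s ^ 2 ≤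
          (Chebyshev.T ℝ (m + 1)).eval (1 + 2 * s) := by linarith
      refine ⟨by exact_mod_cast hT, ?_⟩
      have hrec := congrArg (eval (1 + 2 * s)) (Chebyshev.T_add_two ℝ m)
      simp only [eval_sub, eval_mul, eval_ofNat, eval_X] at hrec
      have hlin : (1 : ℝ) + 2 * ((m : ℝ) + 1) ^ 2 * s ≤
          (Chebyshev.T ℝ (m + 1)).eval (1 + 2 * s) := by
        have : 0 ≤ 2 / 3 * ((m : ℝ) + 1) ^ 2 * (((m : ℝ) + 1) ^ 2 - 1) * s ^ 2 := by
          have : (0 : ℝ) ≤ ((m : ℝ) + 1) ^ 2 - 1 := by nlinarith [m.cast_nonneg (α := ℝ)]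
          positivity
        linarith
      have hmul := mul_le_mul_of_nonneg_left hlin hs
      push_cast
      rw [show (m : ℤ) + 1 + 1 = m + 2 by ring, hrec]
      linarith
  exact key.1

theorem exists_polynomial_eval_eq_mul_div {n k : ℕ} (hn : 1 ≤ n) (hk : k ≤ n) {T : ℝ[X]}
    (hT : T.natDegree ≤ n) {s : ℝ} (hs : 0 < s) (hTs : T.eval (-s) ≠ 0) (c : ℝ) :
    ∃ q : ℝ[X], q.natDegree ≤ n ∧ ∀ x ∈ Set.Icc (0 : ℝ) 1,
      c * x / (s + x) * (x ^ k - (-s) ^ k * T.eval x / T.eval (-s)) = q.eval x := by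
  set R : ℝ[X] := X ^ k - C ((-s) ^ k / T.eval (-s)) * T with hR
  have hroot : R.IsRoot (-s) := by
    simp [hR, IsRoot, hTs]
  have hfac := mul_divByMonic_eq_iff_isRoot.2 hroot
  have hRdeg : R.natDegree ≤ n :=
    (natDegree_sub_le_of_le ((natDegree_X_pow_le k).trans hk)
      ((natDegree_C_mul_le _ _).trans hT)).trans_eq (max_self n)
  refine ⟨C c * (X * (R /ₘ (X - C (-s)))), ?_, fun x hx => ?_⟩
  · refine (natDegree_C_mul_le _ _).trans (natDegree_mul_le.trans ?_)
    rw [natDegree_divByMonic _ (monic_X_sub_C _), natDegree_X_sub_C, natDegree_X]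
    omega
  · have heval := congrArg (eval x) hfac
    simp only [hR, eval_mul, eval_sub, eval_X, eval_C, eval_pow] at heval ⊢
    have hsx : s + x ≠ 0 := by linarith [hx.1]
    have hcomm : (-s) ^ k * eval x T / eval (-s) T = (-s) ^ k / eval (-s) T * eval x T := by ring
    rw [hcomm, ← heval]
    field_simp
    ring

/-- Approximation of `x ^ (p + k)` obtained by interpolating the Stieltjes kernels in the integral
representation of `x ^ p` at the Chebyshev nodes. -/
theorem exists_polynomial_abs_rpow_sub_le {n k : ℕ} (hn : 1 ≤ n) (hk : k ≤ n) {p : ℝ}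
    (hp : p ∈ Set.Ioo (0 : ℝ) 1) {M b : ℝ} (hb : 0 < b)
    (hbound : ∀ s : ℝ, 0 < s → s ^ k / (Chebyshev.T ℝ n).eval (1 + 2 * s) ≤ M * (b / (s + b))) :
    ∃ q : ℝ[X], q.natDegree ≤ n ∧
      ∀ x ∈ Set.Icc (0 : ℝ) 1, |x ^ k * x ^ p - q.eval x| ≤ M * b ^ p := by
  set T : ℝ[X] := (Chebyshev.T ℝ n).comp (1 - 2 * X) with hTdef
  have hTeval : ∀ x, T.eval x = (Chebyshev.T ℝ n).eval (1 - 2 * x) := fun x => by simp [hTdef]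
  have hTneg : ∀ s, T.eval (-s) = (Chebyshev.T ℝ n).eval (1 + 2 * s) := fun s => by
    rw [hTeval]; congr 1; ring
  have hTdeg : T.natDegree ≤ n := by
    refine natDegree_comp_le.trans ?_
    have h2 : (1 - 2 * X : ℝ[X]).natDegree ≤ 1 := by compute_degree
    have h1 : (Chebyshev.T ℝ n).natDegree = n := by simp [Chebyshev.natDegree_T]
    rw [h1]
    exact (Nat.mul_le_mul_left n h2).trans_eq (mul_one n)
  have hTpos : ∀ s, 0 < s → 0 < T.eval (-s) := fun s hs => by
    rw [hTneg]
    exact zero_lt_one.trans_le (Chebyshev.one_le_eval_T_real n (by linarith))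
  have hTle : ∀ x ∈ Set.Icc (0 : ℝ) 1, |T.eval x| ≤ 1 := fun x hx => by
    rw [hTeval]
    exact Chebyshev.abs_eval_T_real_le_one n (abs_le.2 ⟨by linarith [hx.2], by linarith [hx.1]⟩)
  set I : ℝ → ℝ → ℝ := Real.rpowIntegrand₀₁ p with hI
  set μ : Measure ℝ := volume.restrict (Set.Ioi 0) with hμ
  set e : ℝ → ℝ → ℝ := fun s x => I s x * ((-s) ^ k * T.eval x / T.eval (-s)) with he
  have hIint : ∀ x, 0 ≤ x → Integrable (fun s => I s x) μ := fun x hx =>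
    Real.integrableOn_rpowIntegrand₀₁_Ioi hp hx
  have hepoint : ∀ x ∈ Set.Icc (0 : ℝ) 1, ∀ s, 0 < s → |e s x| ≤ M * I s b := by
    intro x hx s hs
    have hI0 : 0 ≤ I s x := Real.rpowIntegrand₀₁_nonneg hp.1 hs.le hx.1
    have hTp := hTpos s hs
    calc |e s x| = I s x * (s ^ k / T.eval (-s)) * |T.eval x| := by
          simp only [he, abs_mul, abs_div, abs_pow, abs_neg, abs_of_pos hs, abs_of_pos hTp,
            abs_of_nonneg hI0]
          ring
      _ ≤ I s x * (s ^ k / T.eval (-s)) :=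
          mul_le_of_le_one_right (by positivity) (hTle x hx)
      _ ≤ s ^ (p - 1) * (M * (b / (s + b))) := by
          have hle : I s x ≤ s ^ (p - 1) := Real.rpowIntegrand₀₁_le_rpow_sub_one hp hs.le hx.1
          have := hbound s hs
          rw [← hTneg] at this
          exact mul_le_mul hle this (by positivity) (by positivity)
      _ = M * I s b := by
          rw [hI, Real.rpowIntegrand₀₁_eq_pow_div hp hs.le hb.le]
          ring
  have heae : ∀ x ∈ Set.Icc (0 : ℝ) 1, ∀ᵐ s ∂μ, ‖e s x‖ ≤ M * I s b := fun x hx =>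
    (ae_restrict_iff' measurableSet_Ioi).2 (.of_forall fun s hs => hepoint x hx s hs)
  have heint : ∀ x ∈ Set.Icc (0 : ℝ) 1, Integrable (fun s => e s x) μ := by
    intro x hx
    refine Integrable.mono' ((hIint b hb.le).const_mul M) ?_ (heae x hx)
    refine (hIint x hx.1).aestronglyMeasurable.mul (Measurable.aestronglyMeasurable ?_)
    have hTmeas : Measurable fun s : ℝ => T.eval (-s) :=
      (T.continuous.comp continuous_neg).measurable
    fun_prop
  have hsub : ∀ x ∈ Set.Icc (0 : ℝ) 1, Integrable (fun s => x ^ k * I s x - e s x) μ :=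
    fun x hx => ((hIint x hx.1).const_mul _).sub (heint x hx)
  obtain ⟨q, hqdeg, hq⟩ := exists_polynomial_eval_eq_integral (n := n) (μ := μ)
    (Set.Icc_infinite (zero_lt_one (α := ℝ))) (g := fun s x => x ^ k * I s x - e s x)
    ((ae_restrict_iff' measurableSet_Ioi).2 (.of_forall fun s hs => by
      obtain ⟨r, hr, hrx⟩ := exists_polynomial_eval_eq_mul_div hn hk hTdeg hs
        (hTpos s hs).ne' (s ^ (p - 1))
      refine ⟨r, hr, fun x hx => ?_⟩
      rw [← hrx x hx, he, hI]
      simp only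
      rw [Real.rpowIntegrand₀₁_eq_pow_div hp (Set.mem_Ioi.1 hs).le hx.1]
      ring)) hsub
  set c : ℝ := ∫ s in Set.Ioi 0, Real.rpowIntegrand₀₁ p s 1 with hc
  have hcpos : 0 < c := Real.integral_rpowIntegrand₀₁_one_pos hp
  have hrep : ∀ x, 0 ≤ x → x ^ p = c⁻¹ * ∫ s, I s x ∂μ := fun x hx =>
    Real.rpow_eq_const_mul_integral hp hx
  refine ⟨C c⁻¹ * q, (natDegree_C_mul_le _ _).trans hqdeg, fun x hx => ?_⟩
  have herr : x ^ k * x ^ p - (C c⁻¹ * q).eval x = c⁻¹ * ∫ s, e s x ∂μ := by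
    rw [eval_mul, eval_C, ← hq x hx, integral_sub ((hIint x hx.1).const_mul _) (heint x hx),
      integral_const_mul, hrep x hx.1]
    ring
  rw [herr, abs_mul, abs_of_pos (inv_pos.2 hcpos), hrep b hb.le, mul_left_comm]
  refine mul_le_mul_of_nonneg_left ?_ (inv_pos.2 hcpos).le
  rw [← integral_const_mul]
  exact norm_integral_le_of_norm_le ((hIint b hb.le).const_mul M) (heae x hx)

theorem approxErr_le {f : ℝ → ℝ} {L : ℕ} {a b ε : ℝ} (hab : a ≤ b) (p : ℝ[X])
    (hp : p.natDegree ≤ L) (h : ∀ x ∈ Set.Icc a b, |f x - p.eval x| ≤ ε) :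
    approxErr f L a b ≤ ε := by
  have : Nonempty (Set.Icc a b) := ⟨⟨a, Set.left_mem_Icc.2 hab⟩⟩
  refine (ciInf_le ⟨0, ?_⟩ (⟨p, hp⟩ : {p : ℝ[X] // p.natDegree ≤ L})).trans
    (ciSup_le fun x => h x x.2)
  rintro _ ⟨q, rfl⟩
  exact Real.iSup_nonneg fun _ => abs_nonneg _

theorem approxErr_xalpha_upper_bound (n : ℕ) (hn : 1 ≤ n) (α : ℝ) :
    (0 < α → α < 1 →
      approxErr (fun x => x ^ α) n 0 1 ≤ (Real.pi / (2 * (n : ℝ))) ^ (2 * α)) ∧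
    (1 < α → α < 3 / 2 →
      approxErr (fun x => x ^ α) n 0 1 ≤ 3 / 2 * (Real.pi / (n : ℝ)) ^ (2 * α)) := by
  have hn1 : (1 : ℝ) ≤ n := by exact_mod_cast hn
  have hnpos : (0 : ℝ) < n := by linarith
  have hpi := Real.pi_gt_three
  have hsq : ∀ y : ℝ, 0 ≤ y → y ^ (2 * α) = (y ^ 2) ^ α := fun y hy => by
    rw [Real.rpow_mul hy, Real.rpow_two]
  constructor
  · intro h0 h1
    obtain ⟨q, hq, hqx⟩ := exists_polynomial_abs_rpow_sub_le (k := 0) (M := 1)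
      (b := 1 / (2 * (n : ℝ) ^ 2)) hn (Nat.zero_le n) ⟨h0, h1⟩ (by positivity) fun s hs => by
        have hT := quadratic_le_eval_chebyshev_T n hs.le
        have hquad : 0 ≤ 2 / 3 * (n : ℝ) ^ 2 * ((n : ℝ) ^ 2 - 1) * s ^ 2 := by
          have : (0 : ℝ) ≤ (n : ℝ) ^ 2 - 1 := by nlinarith
          positivity
        have heq : 1 * (1 / (2 * (n : ℝ) ^ 2) / (s + 1 / (2 * (n : ℝ) ^ 2))) =
            1 / (1 + 2 * (n : ℝ) ^ 2 * s) := by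
          field_simp
          ring
        rw [heq, pow_zero]
        exact one_div_le_one_div_of_le (by positivity) (by linarith)
    refine approxErr_le zero_le_one q hq fun x hx => ?_
    have hx' := hqx x hx
    rw [pow_zero, one_mul, one_mul] at hx'
    refine hx'.trans ?_
    rw [hsq _ (by positivity)]
    refine Real.rpow_le_rpow (by positivity) ?_ h0.le
    rw [div_pow, div_le_div_iff₀ (by positivity) (by positivity)]
    have hpi2 : 2 ≤ Real.pi ^ 2 := by nlinarith
    nlinarith [mul_le_mul_of_nonneg_right hpi2 (sq_nonneg (n : ℝ))]
  · intro h1 h2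
    rcases hn.eq_or_lt with rfl | hn2
    · refine approxErr_le zero_le_one 0 (by simp) fun x hx => ?_
      have hx1 : x ^ α ≤ 1 := Real.rpow_le_one hx.1 hx.2 (by linarith)
      have hpi1 : 1 ≤ (Real.pi / ((1 : ℕ) : ℝ)) ^ (2 * α) :=
        Real.one_le_rpow (by simp; linarith) (by linarith)
      rw [eval_zero, sub_zero, abs_of_nonneg (Real.rpow_nonneg hx.1 _)]
      linarith
    · have hn2' : (2 : ℝ) ≤ n := by exact_mod_cast hn2
      obtain ⟨q, hq, hqx⟩ := exists_polynomial_abs_rpow_sub_le (k := 1) (p := α - 1)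
        (M := 2 / (n : ℝ) ^ 2) (b := 2 / (n : ℝ) ^ 2) hn hn ⟨by linarith, by linarith⟩
        (by positivity) fun s hs => by
          have hT := quadratic_le_eval_chebyshev_T n hs.le
          have hquad : 1 / 2 * ((n : ℝ) ^ 2) ^ 2 * s ^ 2 ≤
              2 / 3 * (n : ℝ) ^ 2 * ((n : ℝ) ^ 2 - 1) * s ^ 2 := by
            refine mul_le_mul_of_nonneg_right ?_ (sq_nonneg s)
            have hn4 : (4 : ℝ) ≤ (n : ℝ) ^ 2 := by nlinarith
            nlinarith
          have heq : 2 / (n : ℝ) ^ 2 * (2 / (n : ℝ) ^ 2 / (s + 2 / (n : ℝ) ^ 2)) =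
              s / (s * ((n : ℝ) ^ 2 / 2) * (1 + (n : ℝ) ^ 2 / 2 * s)) := by
            field_simp
            ring
          rw [heq, pow_one]
          refine div_le_div_of_nonneg_left hs.le (by positivity) ?_
          have : 0 ≤ (n : ℝ) ^ 2 * s := by positivity
          nlinarith [sq_nonneg ((n : ℝ) ^ 2 * s)]
      refine approxErr_le zero_le_one q hq fun x hx => ?_
      have hsplit : ∀ y : ℝ, 0 ≤ y → y * y ^ (α - 1) = y ^ α := fun y hy => by
        rw [← Real.rpow_one_add' hy (by linarith)]
        congr 1
        ring
      have hx' := hqx x hx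
      rw [pow_one, hsplit x hx.1, hsplit _ (by positivity)] at hx'
      refine hx'.trans ?_
      have hle : (2 / (n : ℝ) ^ 2) ^ α ≤ (Real.pi / n) ^ (2 * α) := by
        rw [hsq _ (by positivity), div_pow]
        refine Real.rpow_le_rpow (by positivity) ?_ (by linarith)
        gcongr
        nlinarith
      have : 0 ≤ (Real.pi / (n : ℝ)) ^ (2 * α) := by positivity
      linarith
end

section
/- There exists a universal constant D₁ > 0 such that for every α ∈ (1, 3/2) and every integer n ≥ 1 there is a real polynomial R of degree at most n with constant coefficient equal to 0 such that |R(x) − x^α| ≤ D₁·x·n^{−2(α−1)} for all x ∈ [0, 1], and moreover sup_{x ∈ [0,1]} |R(x) − x^α| ≤ 3·(π/n)^{2α}. -/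
open Filter Topology Finset

/-- Up to a common factor, the cosine coefficients of `|sin t| ^ (2 * α)`: the function is
proportional to `∑ j, sinPowCoeff α j * (1 - cos (2 * (j + 1) * t))`. -/
noncomputable def sinPowCoeff (α : ℝ) : ℕ → ℝ
  | 0 => 1
  | j + 1 => sinPowCoeff α j * ((j + 1 - α) / (j + 2 + α))

/-- The series `∑ j, sinPowCoeff α j * (1 - cos (2 * (j + 1) * t))`. -/
noncomputable def sinPowSeries (α t : ℝ) : ℝ :=
  ∑' j : ℕ, sinPowCoeff α j * (1 - Real.cos (2 * (j + 1) * t))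

/-- The partial sum of `sinPowSeries` as a polynomial in `x = sin t ^ 2`. -/
noncomputable def sinPowPoly (α : ℝ) (n : ℕ) : Polynomial ℝ :=
  ∑ j ∈ range n, Polynomial.C (sinPowCoeff α j) *
    (1 - (Polynomial.Chebyshev.T ℝ ((j + 1 : ℕ) : ℤ)).comp (1 - 2 * Polynomial.X))

lemma sinPowCoeff_recurrence {α : ℝ} (hα : 0 < α) (j : ℕ) :
    (j + 2 + α) * sinPowCoeff α (j + 1) = (j + 1 - α) * sinPowCoeff α j := by
  have : (j : ℝ) + 2 + α ≠ 0 := by positivity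
  rw [sinPowCoeff]
  field_simp

lemma sinPowCoeff_nonpos {α : ℝ} (h₁ : 1 < α) (h₂ : α < 2) {n : ℕ} (hn : 1 ≤ n) :
    sinPowCoeff α n ≤ 0 := by
  induction n, hn using Nat.le_induction with
  | base =>
    simp only [sinPowCoeff, one_mul, Nat.cast_zero]
    exact div_nonpos_of_nonpos_of_nonneg (by linarith) (by linarith)
  | succ n hn ih =>
    have : (1 : ℝ) ≤ n := by exact_mod_cast hn
    rw [sinPowCoeff]
    exact mul_nonpos_of_nonpos_of_nonneg ih (div_nonneg (by linarith) (by positivity))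

lemma sum_range_sinPowCoeff {α : ℝ} (hα : 0 < α) (n K : ℕ) :
    2 * α * ∑ i ∈ range K, -sinPowCoeff α (n + i) =
      (n + 1 + α) * -sinPowCoeff α n - (n + K + 1 + α) * -sinPowCoeff α (n + K) := by
  induction K with
  | zero => simp
  | succ K ih =>
    have h := sinPowCoeff_recurrence hα (n + K)
    rw [sum_range_succ, mul_add, ih, ← add_assoc n K 1]
    push_cast at h ⊢
    linear_combination -h

lemma sum_range_sq_mul_sinPowCoeff {α : ℝ} (hα : 0 < α) (n K : ℕ) :
    2 * (α - 1) * ∑ i ∈ range K, ((n + i : ℕ) + 1 : ℝ) ^ 2 * -sinPowCoeff α (n + i) =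
      n * (n + 1) * (n + 1 + α) * -sinPowCoeff α n -
        (n + K) * (n + K + 1) * (n + K + 1 + α) * -sinPowCoeff α (n + K) := by
  induction K with
  | zero => simp
  | succ K ih =>
    have h := sinPowCoeff_recurrence hα (n + K)
    rw [sum_range_succ, mul_add, ih, ← add_assoc n K 1]
    push_cast at h ⊢
    linear_combination -(n + K + 1) * (n + K + 2) * h

lemma sum_range_sinPowCoeff_le {α : ℝ} (h₁ : 1 < α) (h₂ : α < 2) {n : ℕ} (hn : 1 ≤ n) (K : ℕ) :
    ∑ i ∈ range K, -sinPowCoeff α (n + i) ≤ (n + 1 + α) * -sinPowCoeff α n / (2 * α) := by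
  have h := sum_range_sinPowCoeff (by linarith : 0 < α) n K
  have h0 : 0 ≤ -sinPowCoeff α (n + K) := by
    have := sinPowCoeff_nonpos h₁ h₂ (by omega : 1 ≤ n + K)
    linarith
  have : 0 ≤ (n + K + 1 + α) * -sinPowCoeff α (n + K) := mul_nonneg (by positivity) h0
  rw [le_div_iff₀ (by linarith)]
  linarith

lemma sum_range_sq_mul_sinPowCoeff_le {α : ℝ} (h₁ : 1 < α) (h₂ : α < 2) {n : ℕ} (hn : 1 ≤ n)
    (K : ℕ) :
    ∑ i ∈ range K, ((n + i : ℕ) + 1 : ℝ) ^ 2 * -sinPowCoeff α (n + i) ≤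
      n * (n + 1) * (n + 1 + α) * -sinPowCoeff α n / (2 * (α - 1)) := by
  have h := sum_range_sq_mul_sinPowCoeff (by linarith : 0 < α) n K
  have h0 : 0 ≤ -sinPowCoeff α (n + K) := by
    have := sinPowCoeff_nonpos h₁ h₂ (by omega : 1 ≤ n + K)
    linarith
  have : 0 ≤ (n + K) * (n + K + 1) * (n + K + 1 + α) * -sinPowCoeff α (n + K) :=
    mul_nonneg (by positivity) h0
  rw [le_div_iff₀ (by linarith)]
  linarith

lemma ratio_le_rpow {α : ℝ} (h₁ : 1 < α) {k : ℝ} (hk : 0 < k) :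
    (k + 1 - α) / (k + 2 + α) ≤
      (k + 1) / (k + 2) * (k / (k + 1)) ^ α * ((k + 1 + α) / (k + 2 + α)) ^ α := by
  have e1 : (k + 1 - α) / (k + 1) ≤ (k / (k + 1)) ^ α := by
    have := one_add_mul_self_le_rpow_one_add (s := -(1 / (k + 1)))
      (by rw [neg_le_neg_iff, div_le_one (by positivity)]; linarith) h₁.le
    convert this using 1
    · field_simp
      ring
    · congr 1
      field_simp
      ring
  have e2 : (k + 2) / (k + 2 + α) ≤ ((k + 1 + α) / (k + 2 + α)) ^ α := by
    have := one_add_mul_self_le_rpow_one_add (s := -(1 / (k + 2 + α)))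
      (by rw [neg_le_neg_iff, div_le_one (by positivity)]; linarith) h₁.le
    convert this using 1
    · field_simp
      ring
    · congr 1
      field_simp
      ring
  calc (k + 1 - α) / (k + 2 + α)
      = (k + 1) / (k + 2) * ((k + 1 - α) / (k + 1)) * ((k + 2) / (k + 2 + α)) := by field_simp
    _ ≤ _ := by gcongr

lemma neg_sinPowCoeff_le_rpow {α : ℝ} (h₁ : 1 < α) (h₂ : α < 2) {n : ℕ} (hn : 1 ≤ n) :
    -sinPowCoeff α n ≤ (α - 1) / (2 + α) * (2 / (n + 1)) * (1 / (n : ℝ)) ^ α *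
      ((2 + α) / (n + 1 + α)) ^ α := by
  induction n, hn using Nat.le_induction with
  | base =>
    have : (2 + α) / (((1 : ℕ) : ℝ) + 1 + α) = 1 := by
      rw [div_eq_one_iff_eq (by positivity)]
      push_cast
      ring
    rw [this]
    norm_num [sinPowCoeff]
    rw [← neg_div, neg_sub]
  | succ n hn ih =>
    have hn' : (1 : ℝ) ≤ n := by exact_mod_cast hn
    have hr := ratio_le_rpow h₁ (by linarith : (0 : ℝ) < n)
    have hr0 : 0 ≤ ((n : ℝ) + 1 - α) / (n + 2 + α) := div_nonneg (by linarith) (by positivity)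
    have hα1 : 0 ≤ α - 1 := by linarith
    rw [sinPowCoeff, ← neg_mul]
    refine (mul_le_mul ih hr hr0 (by positivity)).trans_eq ?_
    have e1 : (1 / (n : ℝ)) ^ α * (n / (n + 1)) ^ α = (1 / (n + 1)) ^ α := by
      rw [← Real.mul_rpow (by positivity) (by positivity)]
      congr 1
      field_simp
    have e2 : ((2 + α) / (n + 1 + α)) ^ α * ((n + 1 + α) / (n + 2 + α)) ^ α =
        ((2 + α) / (n + 2 + α)) ^ α := by
      rw [← Real.mul_rpow (by positivity) (by positivity)]
      congr 1
      field_simp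
    have e3 : (2 / ((n : ℝ) + 1)) * ((n + 1) / (n + 2)) = 2 / (n + 2) := by field_simp
    push_cast
    rw [show (n : ℝ) + 1 + 1 + α = n + 2 + α by ring, show (n : ℝ) + 1 + 1 = n + 2 by ring,
      ← e1, ← e2, ← e3]
    ring

lemma succ_mul_neg_sinPowCoeff_le {α : ℝ} (h₁ : 1 < α) (h₂ : α < 3 / 2) {n : ℕ} (hn : 1 ≤ n) :
    (n + 1) * -sinPowCoeff α n ≤ 7 * (α - 1) * (n : ℝ) ^ (-(2 * α)) := by
  have hn0 : (0 : ℝ) < n := by exact_mod_cast hn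
  have hα1 : 0 ≤ α - 1 := by linarith
  have h := neg_sinPowCoeff_le_rpow h₁ (by linarith) hn
  have e1 : ((2 + α) / (n + 1 + α)) ^ α ≤ (2 + α) ^ (2 : ℝ) * (1 / (n : ℝ)) ^ α := by
    calc ((2 + α) / (n + 1 + α)) ^ α ≤ ((2 + α) / n) ^ α := by
          gcongr
          linarith
      _ = (2 + α) ^ α * (1 / (n : ℝ)) ^ α := by
          rw [← Real.mul_rpow (by positivity) (by positivity)]
          congr 1
          ring
      _ ≤ _ := by
          gcongr
          · linarith
          · linarith
  have e2 : (1 / (n : ℝ)) ^ α * (1 / (n : ℝ)) ^ α = (n : ℝ) ^ (-(2 * α)) := by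
    rw [← Real.rpow_add (by positivity), one_div, Real.inv_rpow hn0.le, ← Real.rpow_neg hn0.le]
    congr 1
    ring
  calc (n + 1) * -sinPowCoeff α n
      ≤ (n + 1) * ((α - 1) / (2 + α) * (2 / (n + 1)) * (1 / (n : ℝ)) ^ α *
        ((2 + α) ^ (2 : ℝ) * (1 / (n : ℝ)) ^ α)) := by
          gcongr
          exact h.trans (by gcongr)
    _ = 2 * (2 + α) * (α - 1) * (n : ℝ) ^ (-(2 * α)) := by
          rw [← e2, Real.rpow_two]
          field_simp
    _ ≤ _ := by
          gcongr
          linarith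

lemma summable_sq_mul_abs_sinPowCoeff {α : ℝ} (h₁ : 1 < α) (h₂ : α < 2) :
    Summable fun j : ℕ => ((j : ℝ) + 1) ^ 2 * |sinPowCoeff α j| := by
  rw [← summable_nat_add_iff 1]
  have h (i : ℕ) : |sinPowCoeff α (i + 1)| = -sinPowCoeff α (1 + i) := by
    rw [abs_of_nonpos (sinPowCoeff_nonpos h₁ h₂ (by omega)), add_comm]
  refine summable_of_sum_range_le (fun i => by positivity) fun K =>
    le_trans (le_of_eq (sum_congr rfl fun i _ => ?_))
      (sum_range_sq_mul_sinPowCoeff_le h₁ h₂ le_rfl K)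
  rw [h, add_comm i 1]

lemma summable_mul_abs_sinPowCoeff {α : ℝ} (h₁ : 1 < α) (h₂ : α < 2) :
    Summable fun j : ℕ => ((j : ℝ) + 1) * |sinPowCoeff α j| :=
  (summable_sq_mul_abs_sinPowCoeff h₁ h₂).of_nonneg_of_le (fun j => by positivity) fun j => by
    gcongr
    exact le_self_pow₀ (by linarith [j.cast_nonneg (α := ℝ)]) two_ne_zero

lemma summable_sinPowSeries {α : ℝ} (h₁ : 1 < α) (h₂ : α < 2) (t : ℝ) :
    Summable fun j : ℕ => sinPowCoeff α j * (1 - Real.cos (2 * (j + 1) * t)) := by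
  refine .of_norm_bounded ((summable_mul_abs_sinPowCoeff h₁ h₂).mul_left 2) fun j => ?_
  have h1 := Real.cos_le_one (2 * (j + 1) * t)
  have h2 := Real.neg_one_le_cos (2 * (j + 1) * t)
  have hj := j.cast_nonneg (α := ℝ)
  rw [norm_mul, Real.norm_eq_abs, Real.norm_eq_abs, abs_of_nonneg (a := 1 - _) (by linarith),
    mul_comm, ← mul_assoc]
  gcongr
  linarith

lemma norm_sinPowSeries_deriv_term_le (α : ℝ) (j : ℕ) (t : ℝ) :
    ‖sinPowCoeff α j * (2 * (j + 1) * Real.sin (2 * (j + 1) * t))‖ ≤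
      2 * ((j + 1) * |sinPowCoeff α j|) := by
  have := Real.abs_sin_le_one (2 * (j + 1) * t)
  rw [norm_mul, norm_mul, Real.norm_eq_abs, Real.norm_eq_abs, Real.norm_eq_abs,
    abs_of_nonneg (a := 2 * ((j : ℝ) + 1)) (by positivity)]
  calc |sinPowCoeff α j| * (2 * (j + 1) * |Real.sin (2 * (j + 1) * t)|)
      ≤ |sinPowCoeff α j| * (2 * (j + 1) * 1) := by gcongr
    _ = _ := by ring

lemma hasDerivAt_sinPowSeries {α : ℝ} (h₁ : 1 < α) (h₂ : α < 2) (t : ℝ) :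
    HasDerivAt (sinPowSeries α)
      (∑' j : ℕ, sinPowCoeff α j * (2 * (j + 1) * Real.sin (2 * (j + 1) * t))) t := by
  refine hasDerivAt_tsum (y₀ := 0)
    (g := fun (j : ℕ) y => sinPowCoeff α j * (1 - Real.cos (2 * (j + 1) * y)))
    ((summable_mul_abs_sinPowCoeff h₁ h₂).mul_left 2)
    (fun j y => ?_) (norm_sinPowSeries_deriv_term_le α) (summable_sinPowSeries h₁ h₂ 0) t
  have hlin : HasDerivAt (fun y : ℝ => 2 * ((j : ℝ) + 1) * y) (2 * ((j : ℝ) + 1)) y := by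
    simpa using (hasDerivAt_id y).const_mul (2 * ((j : ℝ) + 1))
  exact ((hlin.cos.const_sub 1).const_mul (sinPowCoeff α j)).congr_deriv (by ring)

lemma sum_range_sinPow_ode {α : ℝ} (hα : 0 < α) (t : ℝ) (N : ℕ) :
    ∑ j ∈ range N, (Real.sin t * (sinPowCoeff α j * (2 * (j + 1) * Real.sin (2 * (j + 1) * t))) -
      2 * α * Real.cos t * (sinPowCoeff α j * (1 - Real.cos (2 * (j + 1) * t)))) =
      -((N + 1 + α) * sinPowCoeff α N * (Real.cos ((2 * N + 1) * t) - Real.cos t)) := by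
  induction N with
  | zero => simp
  | succ N ih =>
    have h := sinPowCoeff_recurrence hα N
    have e1 : Real.cos ((2 * N + 1) * t) = Real.cos (2 * (N + 1) * t) * Real.cos t +
        Real.sin (2 * (N + 1) * t) * Real.sin t := by
      rw [← Real.cos_sub]
      ring_nf
    have e2 : Real.cos ((2 * (N + 1) + 1) * t) = Real.cos (2 * (N + 1) * t) * Real.cos t -
        Real.sin (2 * (N + 1) * t) * Real.sin t := by
      rw [← Real.cos_add]
      ring_nf
    rw [sum_range_succ, ih]
    push_cast
    rw [e1, e2]
    linear_combination (Real.cos (2 * (N + 1) * t) * Real.cos t -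
        Real.sin (2 * (N + 1) * t) * Real.sin t - Real.cos t) * h

lemma sinPowSeries_ode {α : ℝ} (h₁ : 1 < α) (h₂ : α < 2) (t : ℝ) :
    Real.sin t * ∑' j : ℕ, sinPowCoeff α j * (2 * (j + 1) * Real.sin (2 * (j + 1) * t)) =
      2 * α * Real.cos t * sinPowSeries α t := by
  have hs : Summable fun j : ℕ =>
      sinPowCoeff α j * (2 * (j + 1) * Real.sin (2 * (j + 1) * t)) := by
    exact .of_norm_bounded ((summable_mul_abs_sinPowCoeff h₁ h₂).mul_left 2) fun j =>
      norm_sinPowSeries_deriv_term_le α j t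
  have hlim := ((hs.hasSum.mul_left (Real.sin t)).sub
    ((summable_sinPowSeries h₁ h₂ t).hasSum.mul_left (2 * α * Real.cos t))).tendsto_sum_nat
  have hzero : Tendsto (fun N : ℕ => -((N + 1 + α) * sinPowCoeff α N *
      (Real.cos ((2 * N + 1) * t) - Real.cos t))) atTop (𝓝 0) := by
    have h0 := ((summable_mul_abs_sinPowCoeff h₁ h₂).mul_left (6 : ℝ)).tendsto_atTop_zero
    refine squeeze_zero_norm (fun N => ?_) h0
    have hN := N.cast_nonneg (α := ℝ)
    have hc : |Real.cos ((2 * N + 1) * t) - Real.cos t| ≤ 2 := by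
      rw [abs_le]
      constructor <;> linarith [Real.cos_le_one ((2 * N + 1) * t), Real.cos_le_one t,
        Real.neg_one_le_cos ((2 * N + 1) * t), Real.neg_one_le_cos t]
    rw [norm_neg, norm_mul, norm_mul, Real.norm_eq_abs, Real.norm_eq_abs, Real.norm_eq_abs,
      abs_of_nonneg (a := (N : ℝ) + 1 + α) (by positivity)]
    calc (N + 1 + α) * |sinPowCoeff α N| * |Real.cos ((2 * N + 1) * t) - Real.cos t|
        ≤ (3 * (N + 1)) * |sinPowCoeff α N| * 2 := by
          gcongr
          linarith
      _ = _ := by ring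
  have := tendsto_nhds_unique hlim
    (hzero.congr fun N => (sum_range_sinPow_ode (by linarith) t N).symm)
  exact sub_eq_zero.mp this

lemma sinPowSeries_eq_mul_rpow {α : ℝ} (h₁ : 1 < α) (h₂ : α < 2) {t : ℝ} (ht0 : 0 ≤ t)
    (htπ : t < Real.pi) :
    sinPowSeries α t = sinPowSeries α (Real.pi / 2) * (Real.sin t ^ 2) ^ α := by
  rcases ht0.eq_or_lt with rfl | ht
  · have : α ≠ 0 := by linarith
    simp [sinPowSeries, Real.zero_rpow this]
  have hd : ∀ y ∈ Set.Ioo 0 Real.pi,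
      HasDerivAt (fun y => sinPowSeries α y * Real.sin y ^ (-(2 * α))) 0 y := by
    intro y hy
    have hsin := Real.sin_pos_of_mem_Ioo hy
    have h := (hasDerivAt_sinPowSeries h₁ h₂ y).mul
      ((Real.hasDerivAt_sin y).rpow_const (p := -(2 * α)) (Or.inl hsin.ne'))
    refine h.congr_deriv ?_
    have hr : Real.sin y ^ (-(2 * α)) = Real.sin y ^ (-(2 * α) - 1) * Real.sin y := by
      rw [← Real.rpow_add_one hsin.ne']
      congr 1
      ring
    rw [hr]
    linear_combination (Real.sin y ^ (-(2 * α) - 1)) * sinPowSeries_ode h₁ h₂ y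
  have hc := isOpen_Ioo.is_const_of_deriv_eq_zero isPreconnected_Ioo
    (fun y hy => (hd y hy).differentiableAt.differentiableWithinAt)
    (fun y hy => (hd y hy).deriv) ⟨ht, htπ⟩
    (⟨by positivity, by linarith [Real.pi_pos]⟩ : Real.pi / 2 ∈ Set.Ioo 0 Real.pi)
  have hsin := Real.sin_pos_of_mem_Ioo ⟨ht, htπ⟩
  simp only [Real.sin_pi_div_two, Real.one_rpow, mul_one] at hc
  rw [← hc, mul_assoc, ← Real.rpow_natCast, ← Real.rpow_mul hsin.le, ← Real.rpow_add hsin]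
  simp

/-- A bound on the tail of `sinPowSeries` in which the cosine terms are dominated by `w`. -/
lemma abs_sub_sinPowSeries_le {α : ℝ} (h₁ : 1 < α) (h₂ : α < 2) {n : ℕ} (hn : 1 ≤ n) {t B : ℝ}
    {w : ℕ → ℝ} (hw : ∀ j : ℕ, 1 - Real.cos (2 * (j + 1) * t) ≤ w j)
    (hB : ∀ K, ∑ i ∈ range K, w (n + i) * -sinPowCoeff α (n + i) ≤ B) :
    |∑ j ∈ range n, sinPowCoeff α j * (1 - Real.cos (2 * (j + 1) * t)) - sinPowSeries α t| ≤
      B := by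
  rw [sinPowSeries, ← (summable_sinPowSeries h₁ h₂ t).sum_add_tsum_nat_add n, sub_add_cancel_left,
    ← tsum_neg]
  have hs (i : ℕ) : 0 ≤ -sinPowCoeff α (n + i) := by
    have := sinPowCoeff_nonpos h₁ h₂ (by omega : 1 ≤ n + i)
    linarith
  have hpos (i : ℕ) : 0 ≤ -(sinPowCoeff α (i + n) *
      (1 - Real.cos (2 * ((i + n : ℕ) + 1) * t))) := by
    rw [← neg_mul, add_comm i n]
    exact mul_nonneg (hs i) (by linarith [Real.cos_le_one (2 * ((n + i : ℕ) + 1) * t)])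
  rw [abs_of_nonneg (tsum_nonneg hpos)]
  refine Real.tsum_le_of_sum_range_le hpos fun K => (sum_le_sum fun i _ => ?_).trans (hB K)
  rw [← neg_mul, mul_comm, add_comm i n]
  exact mul_le_mul_of_nonneg_right (hw _) (hs i)

lemma one_le_sinPowSeries_pi_div_two {α : ℝ} (h₁ : 1 < α) (h₂ : α < 2) :
    1 ≤ sinPowSeries α (Real.pi / 2) := by
  have h := abs_sub_sinPowSeries_le h₁ h₂ le_rfl (t := Real.pi / 2) (w := fun _ => 2)
    (B := 2 * ((((1 : ℕ) : ℝ) + 1 + α) * -sinPowCoeff α 1 / (2 * α)))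
    (fun j => by linarith [Real.neg_one_le_cos (2 * (j + 1) * (Real.pi / 2))])
    (fun K => by
      rw [← mul_sum]
      exact mul_le_mul_of_nonneg_left (sum_range_sinPowCoeff_le h₁ h₂ le_rfl K) zero_le_two)
  have e1 : ∑ j ∈ range 1, sinPowCoeff α j * (1 - Real.cos (2 * (j + 1) * (Real.pi / 2))) = 2 := by
    have : 2 * (Real.pi / 2) = Real.pi := by ring
    norm_num [sinPowCoeff, this]
  have e2 : 2 * ((((1 : ℕ) : ℝ) + 1 + α) * -sinPowCoeff α 1 / (2 * α)) ≤ 1 := by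
    have h0 := sinPowCoeff_recurrence (by linarith : 0 < α) 0
    simp only [sinPowCoeff, Nat.cast_zero, zero_add, mul_one] at h0
    rw [← mul_div_assoc, div_le_one (by linarith)]
    simp only [sinPowCoeff, Nat.cast_zero, Nat.cast_one, zero_add]
    linarith
  rw [e1] at h
  linarith [(abs_le.mp h).2]

lemma one_sub_cos_two_mul_nat_mul_le (k : ℕ) (t : ℝ) :
    1 - Real.cos (2 * k * t) ≤ 2 * Real.sin t ^ 2 * (k : ℝ) ^ 2 := by
  have h : |Real.sin (k * t)| ≤ k * |Real.sin t| := by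
    induction k with
    | zero => simp
    | succ k ih =>
      push_cast
      rw [add_mul, one_mul, Real.sin_add]
      calc |Real.sin (k * t) * Real.cos t + Real.cos (k * t) * Real.sin t|
          ≤ |Real.sin (k * t)| * |Real.cos t| + |Real.cos (k * t)| * |Real.sin t| := by
            rw [← abs_mul, ← abs_mul]
            exact abs_add_le _ _
        _ ≤ (k * |Real.sin t|) * 1 + 1 * |Real.sin t| := by
            gcongr
            · exact Real.abs_cos_le_one t
            · exact Real.abs_cos_le_one _
        _ = _ := by ring
  have h2 : Real.sin (k * t) ^ 2 ≤ (k * Real.sin t) ^ 2 := by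
    rw [sq_le_sq, abs_mul, Nat.abs_cast]
    exact h
  have h3 := Real.cos_sq_add_sin_sq (k * t)
  rw [mul_assoc, Real.cos_two_mul]
  nlinarith

lemma natDegree_sinPowPoly_le (α : ℝ) (n : ℕ) : (sinPowPoly α n).natDegree ≤ n := by
  refine Polynomial.natDegree_sum_le_of_forall_le _ _ fun j hj => ?_
  refine (Polynomial.natDegree_C_mul_le _ _).trans ((Polynomial.natDegree_sub_le _ _).trans ?_)
  have hdeg : (1 - 2 * Polynomial.X : Polynomial ℝ).natDegree ≤ 1 := by compute_degree
  rw [Polynomial.natDegree_one, Polynomial.natDegree_comp, Polynomial.Chebyshev.natDegree_T,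
    Int.natAbs_natCast]
  have := mem_range.mp hj
  exact max_le (by omega) ((Nat.mul_le_mul_left _ hdeg).trans (by omega))

lemma coeff_zero_sinPowPoly (α : ℝ) (n : ℕ) : (sinPowPoly α n).coeff 0 = 0 := by
  rw [Polynomial.coeff_zero_eq_eval_zero, sinPowPoly, Polynomial.eval_finsetSum]
  exact sum_eq_zero fun j _ => by simp [Polynomial.eval_comp]

lemma eval_sinPowPoly (α : ℝ) (n : ℕ) (t : ℝ) :
    (sinPowPoly α n).eval (Real.sin t ^ 2) =
      ∑ j ∈ range n, sinPowCoeff α j * (1 - Real.cos (2 * (j + 1) * t)) := by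
  rw [sinPowPoly, Polynomial.eval_finsetSum]
  refine sum_congr rfl fun j _ => ?_
  have h : (1 - 2 * Polynomial.X : Polynomial ℝ).eval (Real.sin t ^ 2) = Real.cos (2 * t) := by
    simp only [Polynomial.eval_sub, Polynomial.eval_one, Polynomial.eval_mul,
      Polynomial.eval_ofNat, Polynomial.eval_X, Real.cos_two_mul]
    linarith [Real.cos_sq_add_sin_sq t]
  rw [Polynomial.eval_mul, Polynomial.eval_C, Polynomial.eval_sub, Polynomial.eval_one,
    Polynomial.eval_comp, h, Polynomial.Chebyshev.T_real_cos]
  push_cast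
  ring_nf

theorem exists_pointwise_poly_approx_xalpha :
    ∃ D₁ : ℝ, 0 < D₁ ∧
      ∀ α : ℝ, 1 < α → α < 3 / 2 →
        ∀ n : ℕ, 1 ≤ n →
          ∃ R : Polynomial ℝ, R.natDegree ≤ n ∧ R.coeff 0 = 0 ∧
            (∀ x ∈ Set.Icc (0 : ℝ) 1,
              |R.eval x - x ^ α| ≤ D₁ * x * (n : ℝ) ^ (-(2 * (α - 1)))) ∧
            (∀ x ∈ Set.Icc (0 : ℝ) 1,
              |R.eval x - x ^ α| ≤ 3 * (Real.pi / (n : ℝ)) ^ (2 * α)) := by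
  refine ⟨28, by norm_num, fun α h₁ h₃ n hn => ?_⟩
  have h₂ : α < 2 := by linarith
  have hn1 : (1 : ℝ) ≤ n := by exact_mod_cast hn
  have hn0 : (0 : ℝ) < n := by linarith
  have hcoeff := succ_mul_neg_sinPowCoeff_le h₁ h₃ hn
  have hcn : 0 ≤ -sinPowCoeff α n := by linarith [sinPowCoeff_nonpos h₁ h₂ hn]
  set C := sinPowSeries α (Real.pi / 2) with hC
  have hC1 : 1 ≤ C := one_le_sinPowSeries_pi_div_two h₁ h₂
  have key (x B : ℝ) (hx : x ∈ Set.Icc (0 : ℝ) 1) (w : ℕ → ℝ)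
      (hw : ∀ t, Real.sin t ^ 2 = x → ∀ j : ℕ, 1 - Real.cos (2 * (j + 1) * t) ≤ w j)
      (hB : ∀ K, ∑ i ∈ range K, w (n + i) * -sinPowCoeff α (n + i) ≤ B) :
      |(Polynomial.C C⁻¹ * sinPowPoly α n).eval x - x ^ α| ≤ B := by
    set t := Real.arcsin (Real.sqrt x) with ht
    have hsin : Real.sin t ^ 2 = x := by
      rw [ht, Real.sin_arcsin (by linarith [Real.sqrt_nonneg x]) (Real.sqrt_le_one.mpr hx.2),
        Real.sq_sqrt hx.1]
    have hser := sinPowSeries_eq_mul_rpow h₁ h₂ (t := t)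
      (Real.arcsin_nonneg.mpr (Real.sqrt_nonneg x))
      ((Real.arcsin_le_pi_div_two _).trans_lt (by linarith [Real.pi_pos]))
    have hmain := abs_sub_sinPowSeries_le h₁ h₂ hn (hw t hsin) hB
    rw [← eval_sinPowPoly, hser, hsin, ← hC] at hmain
    have hC0 : C ≠ 0 := by positivity
    have : (Polynomial.C C⁻¹ * sinPowPoly α n).eval x - x ^ α =
        C⁻¹ * ((sinPowPoly α n).eval x - C * x ^ α) := by
      rw [Polynomial.eval_mul, Polynomial.eval_C]
      field_simp
    rw [this, abs_mul, abs_of_pos (by positivity : 0 < C⁻¹)]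
    exact (mul_le_of_le_one_left (abs_nonneg _) (inv_le_one_of_one_le₀ hC1)).trans hmain
  refine ⟨Polynomial.C C⁻¹ * sinPowPoly α n,
    (Polynomial.natDegree_C_mul_le _ _).trans (natDegree_sinPowPoly_le α n),
    by rw [Polynomial.coeff_C_mul, coeff_zero_sinPowPoly, mul_zero], fun x hx => ?_, fun x hx => ?_⟩
  · have hx0 := hx.1
    refine (key x (2 * x * (n * (n + 1) * (n + 1 + α) * -sinPowCoeff α n / (2 * (α - 1)))) hx
      (fun j => 2 * x * ((j : ℝ) + 1) ^ 2) (fun t ht j => ?_) fun K => ?_).trans ?_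
    · have := one_sub_cos_two_mul_nat_mul_le (j + 1) t
      rw [ht] at this
      exact_mod_cast this
    · simp_rw [mul_assoc (2 * x)]
      rw [← mul_sum]
      exact mul_le_mul_of_nonneg_left (sum_range_sq_mul_sinPowCoeff_le h₁ h₂ hn K) (by positivity)
    · have hα : 0 < α - 1 := by linarith
      have hpow : (n : ℝ) ^ (-(2 * (α - 1))) = n ^ 2 * (n : ℝ) ^ (-(2 * α)) := by
        rw [← Real.rpow_natCast, ← Real.rpow_add hn0]
        congr 1
        push_cast
        ring
      calc 2 * x * (n * (n + 1) * (n + 1 + α) * -sinPowCoeff α n / (2 * (α - 1)))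
          = x * n * (n + 1 + α) / (α - 1) * ((n + 1) * -sinPowCoeff α n) := by
            field_simp
        _ ≤ x * n * (4 * n) / (α - 1) * (7 * (α - 1) * (n : ℝ) ^ (-(2 * α))) := by
            gcongr
            linarith
        _ = 28 * x * (n ^ 2 * (n : ℝ) ^ (-(2 * α))) := by
            field_simp
            ring
        _ = _ := by rw [hpow]
  · refine (key x (2 * ((n + 1 + α) * -sinPowCoeff α n / (2 * α))) hx (fun _ => 2)
      (fun t _ j => by linarith [Real.neg_one_le_cos (2 * (j + 1) * t)]) fun K => ?_).trans ?_
    · rw [← mul_sum]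
      exact mul_le_mul_of_nonneg_left (sum_range_sinPowCoeff_le h₁ h₂ hn K) zero_le_two
    · have hpi : (3 : ℝ) ≤ Real.pi ^ (2 * α) :=
        Real.pi_gt_three.le.trans (Real.self_le_rpow_of_one_le
          (by linarith [Real.pi_gt_three]) (by linarith))
      have hnpos : 0 ≤ (n : ℝ) ^ (-(2 * α)) := by positivity
      calc 2 * ((n + 1 + α) * -sinPowCoeff α n / (2 * α))
          = (n + 1 + α) / α * -sinPowCoeff α n := by
            field_simp
        _ ≤ (2 * (n + 1)) * -sinPowCoeff α n := by
            gcongr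
            rw [div_le_iff₀ (by linarith)]
            nlinarith
        _ ≤ 2 * (7 * (α - 1) * (n : ℝ) ^ (-(2 * α))) := by
            rw [mul_assoc]
            gcongr
        _ ≤ 3 * (3 * (n : ℝ) ^ (-(2 * α))) := by nlinarith
        _ ≤ 3 * (Real.pi ^ (2 * α) * (n : ℝ) ^ (-(2 * α))) := by gcongr
        _ = _ := by
            rw [Real.div_rpow Real.pi_pos.le hn0.le, Real.rpow_neg hn0.le, div_eq_mul_inv]
end
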